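/- arXiv:1504.03755 — 2 statements merged into one kernel-verified Lean document; each statement's English description precedes it below -/
import Mathlib

section
/- Let (K, δ) be a differentially closed differential field of characteristic zero. Fix m, n ∈ ℕ and a finite Boolean combination φ of conditions of the form f = 0, where each f is a differential polynomial over K in the variables u₁, …, u_m, x₁, …, xₙ. For a ∈ K^m, define the differential dimension of the set defined by φ(a, ·) to be the largest d such that there exist a differential field extension (L, δ) of K and b ∈ L^n satisfying φ(a, b) for which some d of the coordinates b_{i₁}, …, b_{i_d} are differentially independent over K (i.e., the family (δ^j b_{i_k})_{1 ≤ k ≤ d, j ∈ ℕ} is algebraically independent over K). Then for every d ∈ ℕ, the set { a ∈ K^m : φ(a, ·) defines a nonempty set whose differential dimension equals d } is a differentially constructible subset of K^m. (This is Lemma 2.23 of the paper: differential dimension is definable in families.) -/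
universe u

/-- `δ` is a derivation: additive and satisfying the Leibniz rule. -/
def IsDerivationFn {R : Type*} [CommRing R] (δ : R → R) : Prop :=
  (∀ a b, δ (a + b) = δ a + δ b) ∧ (∀ a b, δ (a * b) = a * δ b + b * δ a)

/-- Evaluation of a differential polynomial (an ordinary polynomial in the
indeterminates `x_i^{(j)}`, `(i, j) : σ × ℕ`) at a point `a` of a differential
ring extension given by a ring hom `ι` and a derivation `δ` on the target:
`x_i^{(j)}` is sent to `δ^j (a i)`. -/
noncomputable def devalMap {K L : Type*} [CommRing K] [CommRing L] (ι : K →+* L)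
    (δ : L → L) {σ : Type*} (f : MvPolynomial (σ × ℕ) K) (a : σ → L) : L :=
  MvPolynomial.eval₂ ι (fun p => δ^[p.2] (a p.1)) f

/-- `(K, δ)` is a differentially closed field: every finite system of differential
polynomial equations with one inequation which is solvable in some differential
field extension of `K` is already solvable in `K`. -/
def DiffClosedField (K : Type u) [Field K] (δ : K → K) : Prop :=
  IsDerivationFn δ ∧
    ∀ (n r : ℕ) (f : Fin r → MvPolynomial (Fin n × ℕ) K)
      (g : MvPolynomial (Fin n × ℕ) K),
      (∃ (L : Type u) (_ : Field L) (ι : K →+* L) (δL : L → L),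
          IsDerivationFn δL ∧ (∀ x, ι (δ x) = δL (ι x)) ∧
          ∃ b : Fin n → L, (∀ i, devalMap ι δL (f i) b = 0) ∧
            devalMap ι δL g b ≠ 0) →
      ∃ a : Fin n → K, (∀ i, devalMap (RingHom.id K) δ (f i) a = 0) ∧
        devalMap (RingHom.id K) δ g a ≠ 0

/-- The Kolchin topology on `σ → K`: the closed sets are the common zero sets of
sets of differential polynomials over `K`. -/
def kolchinTopology (K : Type*) [Field K] (δ : K → K) (σ : Type*) :
    TopologicalSpace (σ → K) :=
  TopologicalSpace.generateFrom
    {U | ∃ f : MvPolynomial (σ × ℕ) K,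
      U = {a | devalMap (RingHom.id K) δ f a ≠ 0}}

/-- A set is constructible w.r.t. a topology `t` if it is a finite union of
differences of `t`-closed sets (equivalently, a finite Boolean combination of
closed sets). -/
def IsConstructibleIn {α : Type*} (t : TopologicalSpace α) (S : Set α) : Prop :=
  ∃ (r : ℕ) (C D : Fin r → Set α),
    (∀ i, @IsClosed _ t (C i)) ∧ (∀ i, @IsClosed _ t (D i)) ∧
    S = ⋃ i, C i \ D i

/-- The differential dimension of the set defined by `φ(a, ·)` is at least `d`:
there are a differential field extension `(L, δL)` of `(K, δ)` and a point
`b ∈ L^n` satisfying `φ(a, b)` such that some `d` of the coordinates of `b` are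
differentially independent over `K`.  Here `φ` is a finite Boolean combination of
equations of differential polynomials in the variables `u₁, …, u_m, x₁, …, xₙ`,
presented in disjunctive normal form by the families `E` (equations) and `G`
(inequations). -/
def DiffDimGe {K : Type u} [Field K] (δ : K → K) {m n p : ℕ} {q r : Fin p → ℕ}
    (E : (k : Fin p) → Fin (q k) → MvPolynomial ((Fin m ⊕ Fin n) × ℕ) K)
    (G : (k : Fin p) → Fin (r k) → MvPolynomial ((Fin m ⊕ Fin n) × ℕ) K)
    (a : Fin m → K) (d : ℕ) : Prop :=
  ∃ (L : Type u) (_ : Field L) (ι : K →+* L) (δL : L → L),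
    IsDerivationFn δL ∧ (∀ x, ι (δ x) = δL (ι x)) ∧
    ∃ b : Fin n → L,
      (∃ k, (∀ i, devalMap ι δL (E k i) (Sum.elim (fun i => ι (a i)) b) = 0) ∧
            (∀ j, devalMap ι δL (G k j) (Sum.elim (fun i => ι (a i)) b) ≠ 0)) ∧
      ∃ s : Fin d → Fin n, Function.Injective s ∧
        ∀ f : MvPolynomial (Fin d × ℕ) K,
          MvPolynomial.eval₂ ι (fun pr => δL^[pr.2] (b (s pr.1))) f = 0 → f = 0

theorem exists_derivation_mvPolynomial {σ R A : Type*} [CommRing R] [CommRing A]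
    [Algebra (MvPolynomial σ R) A] (δ : Derivation ℤ R R) (y : σ → A) :
    ∃ D : Derivation ℤ (MvPolynomial σ R) A,
      (∀ r, D (.C r) = algebraMap (MvPolynomial σ R) A (.C (δ r))) ∧ ∀ i, D (.X i) = y i := by
  let ι : R →+* A := (algebraMap (MvPolynomial σ R) A).comp MvPolynomial.C
  let c : R →+* TrivSqZeroExt A A :=
    { toFun := fun r => .inl (ι r) + .inr (ι (δ r))
      map_one' := by ext <;> simp
      map_zero' := by ext <;> simp
      map_mul' := fun a b => by
        ext
        · simp
        · simp [mul_comm]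
      map_add' := fun a b => by ext <;> simp }
  let h : MvPolynomial σ R →+* TrivSqZeroExt A A :=
    MvPolynomial.eval₂Hom c fun i => .inl (algebraMap (MvPolynomial σ R) A (.X i)) + .inr (y i)
  have hfst : ∀ p, (h p).fst = algebraMap _ A p := by
    have : ((TrivSqZeroExt.fstHom ℤ A A : TrivSqZeroExt A A →+* A).comp h) =
        algebraMap (MvPolynomial σ R) A := by
      ext <;> simp [h, c, ι]
    exact RingHom.congr_fun this
  refine ⟨Derivation.mk' ((TrivSqZeroExt.sndHom A A).toAddMonoidHom.comp
    h.toAddMonoidHom).toIntLinearMap fun a b => ?_, fun r => ?_, fun i => ?_⟩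
  · simp [hfst, Algebra.smul_def]
    exact mul_comm _ _
  · simp [h, c, ι]
    rw [Algebra.smul_def, mul_one]
  · simp [h]

theorem exists_derivation_of_formallyEtale {A B : Type*} [CommRing A] [CommRing B] [Algebra A B]
    [Algebra.FormallyEtale A B] (D : Derivation ℤ A B) :
    ∃ D' : Derivation ℤ B B, ∀ a, D' (algebraMap A B a) = D a := by
  let e := KaehlerDifferential.tensorKaehlerEquivOfFormallyEtale ℤ A B
  refine ⟨(((LinearMap.liftBaseChange B D.liftKaehlerDifferential).comp
    e.symm.toLinearMap).compDer (KaehlerDifferential.D ℤ B)), fun a => ?_⟩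
  simp [e, KaehlerDifferential.tensorKaehlerEquivOfFormallyEtale_symm_D_algebraMap]

theorem exists_isAlgClosed_formallyEtale (P : Type u) [CommRing P] [IsDomain P] [CharZero P] :
    ∃ (L : Type u) (_ : Field L) (_ : Algebra P L), IsAlgClosed L ∧
      Function.Injective (algebraMap P L) ∧ Algebra.FormallyEtale P L := by
  have : CharZero (FractionRing P) :=
    charZero_of_injective_algebraMap (IsFractionRing.injective P (FractionRing P))
  have := Algebra.FormallyEtale.of_isLocalization (Rₘ := FractionRing P) (nonZeroDivisors P)
  have := Algebra.FormallyEtale.of_isSeparable (FractionRing P)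
    (AlgebraicClosure (FractionRing P))
  exact ⟨AlgebraicClosure (FractionRing P), inferInstance, inferInstance, inferInstance,
    (algebraMap (FractionRing P) (AlgebraicClosure (FractionRing P))).injective.comp
      (IsFractionRing.injective P (FractionRing P)),
    Algebra.FormallyEtale.comp P (FractionRing P) _⟩

theorem map_derivation_mvPolynomial {σ R A : Type*} [CommRing R] [CommRing A]
    {D : Derivation ℤ (MvPolynomial σ R) (MvPolynomial σ R)} {δ : Derivation ℤ A A}
    {φ : MvPolynomial σ R →+* A} (hC : ∀ r, φ (D (.C r)) = δ (φ (.C r)))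
    (hX : ∀ i, φ (D (.X i)) = δ (φ (.X i))) (p) : φ (D p) = δ (φ p) := by
  induction p using MvPolynomial.induction_on with
  | C r => exact hC r
  | add p q hp hq => simp [hp, hq]
  | mul_X p i hp => simp [hp, hX]

section OneVariable

variable {R : Type*} [CommRing R]

/-- Evaluate a polynomial over `R[x₀, …, x_{N-1}]` at the variable `x_N`. -/
noncomputable def evalTop (R : Type*) [CommRing R] (N : ℕ) :
    Polynomial (MvPolynomial (Fin N) R) →+* MvPolynomial ℕ R :=
  Polynomial.eval₂RingHom (MvPolynomial.rename (R := R) (Fin.val : Fin N → ℕ)).toRingHom (.X N)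

theorem evalTop_C (N : ℕ) (b : MvPolynomial (Fin N) R) :
    evalTop R N (.C b) = MvPolynomial.rename Fin.val b := by simp [evalTop]

theorem evalTop_X (N : ℕ) : evalTop R N .X = .X N := by simp [evalTop]

theorem X_mem_range_evalTop {N i : ℕ} (hi : i ≤ N) :
    (MvPolynomial.X i : MvPolynomial ℕ R) ∈ (evalTop R N).range := by
  rcases hi.lt_or_eq with hi | rfl
  · exact ⟨.C (.X ⟨i, hi⟩), by simp [evalTop_C]⟩
  · exact ⟨.X, evalTop_X _⟩

theorem C_mem_range_evalTop (N : ℕ) (r : R) :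
    (MvPolynomial.C r : MvPolynomial ℕ R) ∈ (evalTop R N).range :=
  ⟨.C (.C r), by simp [evalTop_C]⟩

theorem rename_mem_range_evalTop {N : ℕ} (p : MvPolynomial (Fin (N + 1)) R) :
    MvPolynomial.rename Fin.val p ∈ (evalTop R N).range := by
  induction p using MvPolynomial.induction_on with
  | C r => simpa using C_mem_range_evalTop N r
  | add p q hp hq => rw [map_add]; exact add_mem hp hq
  | mul_X p i hp =>
    rw [map_mul, MvPolynomial.rename_X]
    exact mul_mem hp (X_mem_range_evalTop (Nat.lt_succ_iff.1 i.2))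

variable {δ : Derivation ℤ R R} {D : Derivation ℤ (MvPolynomial ℕ R) (MvPolynomial ℕ R)}

theorem derivation_rename_mem_range_evalTop (hC : ∀ r, D (.C r) = .C (δ r))
    (hX : ∀ i, D (.X i) = .X (i + 1)) {N : ℕ} (p : MvPolynomial (Fin N) R) :
    D (MvPolynomial.rename Fin.val p) ∈ (evalTop R N).range := by
  induction p using MvPolynomial.induction_on with
  | C r =>
    rw [MvPolynomial.rename_C, hC]
    exact C_mem_range_evalTop N _
  | add p q hp hq => rw [map_add, map_add]; exact add_mem hp hq
  | mul_X p i hp =>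
    rw [map_mul, MvPolynomial.rename_X, D.leibniz, hX]
    exact add_mem (mul_mem ⟨.C p, evalTop_C _ _⟩ (X_mem_range_evalTop i.2))
      (mul_mem (X_mem_range_evalTop i.2.le) hp)

theorem exists_derivation_evalTop_eq (hC : ∀ r, D (.C r) = .C (δ r))
    (hX : ∀ i, D (.X i) = .X (i + 1)) {N : ℕ}
    (P : Polynomial (MvPolynomial (Fin N) R)) :
    ∃ g, D (evalTop R N P) = evalTop R N P.derivative * .X (N + 1) + evalTop R N g := by
  induction P using Polynomial.induction_on' with
  | add P Q hP hQ =>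
    obtain ⟨g, hg⟩ := hP
    obtain ⟨g', hg'⟩ := hQ
    exact ⟨g + g', by simp only [map_add, hg, hg']; ring⟩
  | monomial n b =>
    obtain ⟨g, hg⟩ := derivation_rename_mem_range_evalTop hC hX b
    refine ⟨g * .X ^ n, ?_⟩
    rw [← Polynomial.C_mul_X_pow_eq_monomial]
    simp only [map_mul, map_pow, evalTop_C, evalTop_X, D.leibniz, D.leibniz_pow, hX, hg,
      Polynomial.derivative_C_mul_X_pow, map_natCast, smul_eq_mul, nsmul_eq_mul]
    ring

/-- Modulo a differential ideal containing `f(x₀, …, x_N)`, every differential polynomial becomes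
a polynomial of order at most `N` after multiplication by a power of the separant of `f`. -/
theorem exists_separant_pow_mul_sub_mem (hC : ∀ r, D (.C r) = .C (δ r))
    (hX : ∀ i, D (.X i) = .X (i + 1)) {N : ℕ}
    (f : Polynomial (MvPolynomial (Fin N) R)) (E : MvPolynomial ℕ R) :
    ∃ t E₀, ∀ Q : Ideal (MvPolynomial ℕ R), (∀ g ∈ Q, D g ∈ Q) → evalTop R N f ∈ Q →
      evalTop R N f.derivative ^ t * E - evalTop R N E₀ ∈ Q := by
  set s := evalTop R N f.derivative with hs
  let M : Subring (MvPolynomial ℕ R) :=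
    { carrier := {E | ∃ t E₀, ∀ Q : Ideal (MvPolynomial ℕ R), (∀ g ∈ Q, D g ∈ Q) →
        evalTop R N f ∈ Q → s ^ t * E - evalTop R N E₀ ∈ Q}
      mul_mem' := by
        rintro a b ⟨t, a₀, ha⟩ ⟨t', b₀, hb⟩
        refine ⟨t + t', a₀ * b₀, fun Q hQ hf => ?_⟩
        have := add_mem (Q.mul_mem_left (s ^ t' * b) (ha Q hQ hf))
          (Q.mul_mem_left (evalTop R N a₀) (hb Q hQ hf))
        convert this using 1
        rw [map_mul]; ring
      one_mem' := ⟨0, 1, fun Q _ _ => by simp⟩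
      add_mem' := by
        rintro a b ⟨t, a₀, ha⟩ ⟨t', b₀, hb⟩
        refine ⟨t + t', f.derivative ^ t' * a₀ + f.derivative ^ t * b₀, fun Q hQ hf => ?_⟩
        have := add_mem (Q.mul_mem_left (s ^ t') (ha Q hQ hf))
          (Q.mul_mem_left (s ^ t) (hb Q hQ hf))
        convert this using 1
        simp only [map_add, map_mul, map_pow, ← hs]; ring
      zero_mem' := ⟨0, 0, fun Q _ _ => by simp⟩
      neg_mem' := by
        rintro a ⟨t, a₀, ha⟩
        refine ⟨t, -a₀, fun Q hQ hf => ?_⟩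
        convert neg_mem (ha Q hQ hf) using 1
        rw [map_neg]; ring }
  have hM : ∀ x, x ∈ (evalTop R N).range → x ∈ M := by
    rintro _ ⟨g, rfl⟩
    exact ⟨0, g, fun Q _ _ => by simp⟩
  have hXN : (.X (N + 1) : MvPolynomial ℕ R) ∈ M := by
    obtain ⟨g, hg⟩ := exists_derivation_evalTop_eq hC hX f
    refine ⟨1, -g, fun Q hQ hf => ?_⟩
    convert hQ _ hf using 1
    rw [hg, map_neg]; ring
  have hD : ∀ P, D (evalTop R N P) ∈ M := fun P => by
    obtain ⟨g, hg⟩ := exists_derivation_evalTop_eq hC hX P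
    rw [hg]
    exact add_mem (mul_mem (hM _ ⟨_, rfl⟩) hXN) (hM _ ⟨_, rfl⟩)
  have hMs : ∀ x, s ^ 1 * x ∈ M → x ∈ M := by
    rintro x ⟨t, x₀, hx⟩
    refine ⟨t + 1, x₀, fun Q hQ hf => ?_⟩
    convert hx Q hQ hf using 1
    ring
  have hMD : ∀ x ∈ M, D x ∈ M := by
    rintro x ⟨t, x₀, hx⟩
    have hmem : s * D (evalTop R N x₀) - t * D s * evalTop R N x₀ ∈ M :=
      sub_mem (mul_mem (hM _ ⟨_, rfl⟩) (hD _))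
        (mul_mem (mul_mem (natCast_mem M t) (hD _)) (hM _ ⟨_, rfl⟩))
    obtain ⟨k, y₀, hy⟩ := hmem
    refine ⟨k + (t + 1), y₀, fun Q hQ hf => ?_⟩
    have h₁ := hx Q hQ hf
    have h₂ := hQ _ h₁
    have h₃ := hy Q hQ hf
    have h₄ := add_mem (Q.mul_mem_left (s ^ k * s) h₂)
      (add_mem h₃ (Q.mul_mem_left (-(s ^ k * t * D s)) h₁))
    convert h₄ using 1
    simp only [map_sub, D.leibniz, D.leibniz_pow, smul_eq_mul, nsmul_eq_mul]
    rcases t with _ | t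
    · simp; ring
    · simp only [Nat.add_sub_cancel]; push_cast; ring
  have hXi : ∀ i, (.X i : MvPolynomial ℕ R) ∈ M := fun i => by
    induction i with
    | zero => exact hM _ (X_mem_range_evalTop N.zero_le)
    | succ i ih => rw [← hX]; exact hMD _ ih
  change E ∈ M
  induction E using MvPolynomial.induction_on with
  | C r => exact hM _ (C_mem_range_evalTop N r)
  | add p q hp hq => exact add_mem hp hq
  | mul_X p i hp => exact mul_mem hp (hXi i)

end OneVariable

theorem Polynomial.map_eq_zero_of_forall_map_coeff_eq_zero {A B : Type*} [CommRing A] [CommRing B]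
    (g : Polynomial A →+* B) (f : Polynomial A) (h : ∀ i, g (.C (f.coeff i)) = 0) : g f = 0 := by
  rw [f.as_sum_range_C_mul_X_pow, map_sum]
  exact Finset.sum_eq_zero fun i _ => by rw [map_mul, h, zero_mul]

section Division

variable {B L : Type*} [CommRing B] [Field L] (ψ : B →+* L) (β : L)

/-- Replacement of the minimal polynomial of `β` with coefficients in the image of `B`. -/
theorem exists_minimal_annihilator [CharZero L]
    (h : ∃ f : Polynomial B, f.map ψ ≠ 0 ∧ f.eval₂ ψ β = 0) :
    ∃ f : Polynomial B, ψ f.leadingCoeff ≠ 0 ∧ 0 < f.natDegree ∧ f.eval₂ ψ β = 0 ∧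
      f.derivative.eval₂ ψ β ≠ 0 ∧
      ∀ E : Polynomial B, E.eval₂ ψ β = 0 →
        ∃ D q, ψ D ≠ 0 ∧ (Polynomial.C D * E - q * f).map ψ = 0 := by
  classical
  obtain ⟨f, ⟨hf, hfβ⟩, hmin⟩ := (measure (Polynomial.natDegree (R := B))).wf.has_min
    {f | f.map ψ ≠ 0 ∧ f.eval₂ ψ β = 0} h
  replace hmin : ∀ g : Polynomial B, g.natDegree < f.natDegree → g.eval₂ ψ β = 0 →
      g.map ψ = 0 := fun g hg hgβ => by
    by_contra hne
    exact hmin g ⟨hne, hgβ⟩ hg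
  have hpos : 0 < f.natDegree := by
    by_contra h0
    rw [Polynomial.eq_C_of_natDegree_eq_zero (Nat.eq_zero_of_not_pos h0)] at hf hfβ
    simp_all
  have hlead : ψ f.leadingCoeff ≠ 0 := by
    intro h0
    have he : f.eraseLead.map ψ = f.map ψ := by
      have := congrArg (Polynomial.map ψ) f.eraseLead_add_C_mul_X_pow
      rw [Polynomial.map_add, Polynomial.map_mul, Polynomial.map_C, h0] at this
      simpa using this
    have hlt : f.eraseLead.natDegree < f.natDegree :=
      lt_of_le_of_lt f.eraseLead_natDegree_le (by omega)
    exact hf (he ▸ hmin _ hlt (by rw [Polynomial.eval₂_eq_eval_map, he,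
      ← Polynomial.eval₂_eq_eval_map, hfβ]))
  refine ⟨f, hlead, hpos, hfβ, fun h0 => ?_, fun E => ?_⟩
  · have := hmin _ (Polynomial.natDegree_derivative_lt hpos.ne') h0
    rw [← Polynomial.derivative_map] at this
    have := Polynomial.derivative_eq_zero.1 this
    rw [Polynomial.natDegree_map_of_leadingCoeff_ne_zero ψ hlead] at this
    omega
  · induction hn : E.natDegree using Nat.strong_induction_on generalizing E with
    | _ n ih =>
    intro hE
    subst hn
    rcases lt_or_ge E.natDegree f.natDegree with hlt | hle
    · exact ⟨1, 0, by simp, by simpa using hmin E hlt hE⟩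
    · let E' := Polynomial.C f.leadingCoeff * E -
        Polynomial.C E.leadingCoeff * .X ^ (E.natDegree - f.natDegree) * f
      have hE' : E'.eval₂ ψ β = 0 := by simp [E', hE, hfβ]
      have hdeg : E'.natDegree < E.natDegree := by
        have h1 : E'.natDegree ≤ E.natDegree := by
          refine (Polynomial.natDegree_sub_le _ _).trans (max_le ?_ ?_)
          · exact Polynomial.natDegree_C_mul_le _ _
          · refine Polynomial.natDegree_mul_le.trans ?_
            have := Polynomial.natDegree_C_mul_X_pow_le E.leadingCoeff
              (E.natDegree - f.natDegree)
            omega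
        refine lt_of_le_of_ne h1 fun heq => ?_
        have h2 : E'.coeff E.natDegree = 0 := by
          obtain ⟨k, hk⟩ := Nat.exists_eq_add_of_le hle
          simp only [E', Polynomial.coeff_sub, Polynomial.coeff_C_mul, mul_assoc,
            Polynomial.coeff_X_pow_mul', Polynomial.coeff_natDegree]
          rw [if_pos (by omega), Nat.sub_sub_self hle, Polynomial.coeff_natDegree]
          ring
        rw [← heq, Polynomial.coeff_natDegree, Polynomial.leadingCoeff_eq_zero] at h2
        rw [h2] at heq
        simp at heq
        omega
      obtain ⟨D, q, hD, hq⟩ := ih _ hdeg E' rfl hE'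
      refine ⟨D * f.leadingCoeff,
        q + Polynomial.C D * (Polynomial.C E.leadingCoeff * .X ^ (E.natDegree - f.natDegree)),
        by simpa using ⟨hD, hlead⟩, ?_⟩
      rw [← hq]
      congr 1
      simp only [E', map_mul]
      ring

theorem exists_cofactor (h : ∃ f : Polynomial B, f.map ψ ≠ 0 ∧ f.eval₂ ψ β = 0)
    (H : Polynomial B) (hH : H.eval₂ ψ β ≠ 0) :
    ∃ e q, ψ e ≠ 0 ∧ (Polynomial.C e + H * q).eval₂ ψ β = 0 := by
  obtain ⟨f, hf, hfβ⟩ := h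
  let A := ψ.range
  have hcomp : (algebraMap A L).comp ψ.rangeRestrict = ψ := rfl
  have hβ : IsAlgebraic A β := by
    refine ⟨f.map ψ.rangeRestrict, fun h0 => hf ?_, ?_⟩
    · rw [← hcomp, ← Polynomial.map_map, h0, Polynomial.map_zero]
    · rw [Polynomial.aeval_def, Polynomial.eval₂_map, hcomp, hfβ]
  have hHβ : IsAlgebraic A (H.eval₂ ψ β) := by
    have : H.eval₂ ψ β = Polynomial.aeval β (H.map ψ.rangeRestrict) := by
      rw [Polynomial.aeval_def, Polynomial.eval₂_map, hcomp]
    rw [this]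
    exact Algebra.adjoin_le (S := Subalgebra.algebraicClosure A L)
      (Set.singleton_subset_iff.2 hβ) (Polynomial.aeval_mem_adjoin_singleton A β)
  obtain ⟨p, hp0, hp⟩ := hHβ.exists_nonzero_coeff_and_aeval_eq_zero
    (mem_nonZeroDivisors_of_ne_zero hH)
  obtain ⟨p, rfl⟩ := Polynomial.map_surjective _ ψ.rangeRestrict_surjective p
  refine ⟨p.coeff 0, p.divX.comp H, fun h0 => hp0 ?_, ?_⟩
  · rw [Polynomial.coeff_map]
    exact Subtype.ext h0
  · have : Polynomial.C (p.coeff 0) + H * p.divX.comp H = p.comp H := by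
      conv_rhs => rw [← p.divX_mul_X_add]
      simp; ring
    rw [this, Polynomial.eval₂_comp, ← hp, Polynomial.aeval_def, Polynomial.eval₂_map, hcomp]

end Division

theorem MvPolynomial.map_eq_zero_of_map_eq_zero {σ R A B : Type*} [CommRing R] [CommRing A]
    [CommRing B] (φ : R →+* A) (g : MvPolynomial σ R →+* B) (h : ∀ r, φ r = 0 → g (.C r) = 0)
    {p : MvPolynomial σ R} (hp : MvPolynomial.map φ p = 0) : g p = 0 := by
  rw [p.as_sum, map_sum]
  refine Finset.sum_eq_zero fun i _ => ?_
  have : φ (p.coeff i) = 0 := by rw [← MvPolynomial.coeff_map, hp, MvPolynomial.coeff_zero]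
  rw [← mul_one (p.coeff i), ← MvPolynomial.C_mul_monomial, map_mul, h _ this, zero_mul]

/-- The vanishing of finitely many polynomials and the nonvanishing of another one under a map of
coefficients are detected by finitely many coefficients. -/
theorem exists_coefficients {σ R A : Type*} [CommRing R] [CommRing A] (φ : R →+* A)
    (W : Finset (MvPolynomial σ R)) (Y : MvPolynomial σ R)
    (hW : ∀ w ∈ W, MvPolynomial.map φ w = 0) (hY : MvPolynomial.map φ Y ≠ 0) :
    ∃ (E : Finset R) (g : R), (∀ e ∈ E, φ e = 0) ∧ φ g ≠ 0 ∧
      ∀ (B : Type u) [CommRing B] (χ : R →+* B), (∀ e ∈ E, χ e = 0) → χ g ≠ 0 →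
        (∀ w ∈ W, MvPolynomial.map χ w = 0) ∧ MvPolynomial.map χ Y ≠ 0 := by
  classical
  obtain ⟨i, hi⟩ := MvPolynomial.ne_zero_iff.1 hY
  refine ⟨W.biUnion fun w => w.support.image w.coeff, Y.coeff i, fun e he => ?_, ?_,
    fun B _ χ hE hg => ⟨fun w hw => ?_, fun h0 => hg ?_⟩⟩
  · simp only [Finset.mem_biUnion, Finset.mem_image] at he
    obtain ⟨w, hw, m, -, rfl⟩ := he
    rw [← MvPolynomial.coeff_map, hW w hw, MvPolynomial.coeff_zero]
  · rwa [← MvPolynomial.coeff_map]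
  · ext m
    rw [MvPolynomial.coeff_map, MvPolynomial.coeff_zero]
    by_cases hm : m ∈ w.support
    · exact hE _ (Finset.mem_biUnion.2 ⟨w, hw, Finset.mem_image_of_mem _ hm⟩)
    · rw [MvPolynomial.notMem_support_iff.1 hm, map_zero]
  · rw [← MvPolynomial.coeff_map, h0, MvPolynomial.coeff_zero]

theorem exists_derivation_of_formallyEtale_mvPolynomial {σ F L : Type*} [CommRing F] [CommRing L]
    [Algebra (MvPolynomial σ F) L] [Algebra.FormallyEtale (MvPolynomial σ F) L]
    (δ : Derivation ℤ F F) (y : σ → L) :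
    ∃ D : Derivation ℤ L L,
      (∀ r, D (algebraMap (MvPolynomial σ F) _ (.C r)) =
        algebraMap (MvPolynomial σ F) _ (.C (δ r))) ∧
      ∀ i, D (algebraMap (MvPolynomial σ F) _ (.X i)) = y i := by
  obtain ⟨D₀, hC, hX⟩ := exists_derivation_mvPolynomial δ y
  obtain ⟨D, hD⟩ := exists_derivation_of_formallyEtale D₀
  exact ⟨D, fun r => (hD _).trans (hC r), fun i => (hD _).trans (hX i)⟩

/-- The system `E = 0`, `G ≠ 0` in one differential unknown, with coefficients specialized by `φ`,
is solvable in some differential field extension of `F`. -/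
def SolvableOne {R F : Type u} [CommRing R] [Field F] (δF : Derivation ℤ F F) (φ : R →+* F)
    (E : Finset (MvPolynomial ℕ R)) (G : MvPolynomial ℕ R) : Prop :=
  ∃ (L : Type u) (_ : Field L) (δL : Derivation ℤ L L) (j : F →+* L) (z : L),
    (∀ x, j (δF x) = δL (j x)) ∧
    (∀ e ∈ E, MvPolynomial.eval₂ (j.comp φ) (fun i => δL^[i] z) e = 0) ∧
    MvPolynomial.eval₂ (j.comp φ) (fun i => δL^[i] z) G ≠ 0

section LocalElimination

variable {R : Type u} [CommRing R]

theorem solvableOne_of_generic {F : Type u} [Field F] [CharZero F] (δF : Derivation ℤ F F)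
    (φ : R →+* F) {E : Finset (MvPolynomial ℕ R)} {G : MvPolynomial ℕ R}
    (hE : ∀ e ∈ E, MvPolynomial.map φ e = 0) (hG : MvPolynomial.map φ G ≠ 0) :
    SolvableOne δF φ E G := by
  obtain ⟨L, _, _, -, hinj, _⟩ := exists_isAlgClosed_formallyEtale (MvPolynomial ℕ F)
  obtain ⟨δL, hC, hX⟩ := exists_derivation_of_formallyEtale_mvPolynomial δF
    fun i : ℕ => algebraMap (MvPolynomial ℕ F) L (.X (i + 1))
  let j : F →+* L := (algebraMap (MvPolynomial ℕ F) L).comp MvPolynomial.C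
  have hz : ∀ i, δL^[i] (algebraMap (MvPolynomial ℕ F) L (.X 0)) =
      algebraMap (MvPolynomial ℕ F) L (.X i) := fun i => by
    induction i with
    | zero => rfl
    | succ i ih => rw [Function.iterate_succ_apply', ih, hX]
  have hev : ∀ p, MvPolynomial.eval₂ (j.comp φ)
      (fun i => δL^[i] (algebraMap (MvPolynomial ℕ F) L (.X 0))) p =
        algebraMap (MvPolynomial ℕ F) L (MvPolynomial.map φ p) := fun p => by
    induction p using MvPolynomial.induction_on with
    | C r => simp [j]
    | add p q hp hq => simp [hp, hq]
    | mul_X p i hp => rw [MvPolynomial.eval₂_mul, hp]; simp [hz]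
  refine ⟨L, inferInstance, δL, j, algebraMap (MvPolynomial ℕ F) L (.X 0),
    fun x => (hC x).symm, fun e he => ?_, ?_⟩
  · rw [hev, hE e he, map_zero]
  · rw [hev]
    exact (map_ne_zero_iff _ hinj).2 hG

/-- A zero of `f(x₀, …, x_N)` whose first `N` derivatives are generic. -/
theorem exists_generic_zero {F : Type u} [Field F] [CharZero F] (δF : Derivation ℤ F F)
    (φ : R →+* F) {N : ℕ} (f : Polynomial (MvPolynomial (Fin N) R)) (hdeg : 0 < f.natDegree)
    (hlead : MvPolynomial.map φ f.leadingCoeff ≠ 0) :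
    ∃ (L : Type u) (_ : Field L) (δL : Derivation ℤ L L) (j : F →+* L) (z : L),
      (∀ x, j (δF x) = δL (j x)) ∧
      MvPolynomial.eval₂ (j.comp φ) (fun i => δL^[i] z) (evalTop R N f) = 0 ∧
      ∀ p : MvPolynomial (Fin N) R, MvPolynomial.map φ p ≠ 0 →
        MvPolynomial.eval₂ (j.comp φ) (fun i => δL^[i] z) (MvPolynomial.rename Fin.val p) ≠ 0 := by
  obtain ⟨L, _, _, _, hinj, _⟩ := exists_isAlgClosed_formallyEtale (MvPolynomial (Fin N) F)
  let χ : MvPolynomial (Fin N) R →+* L :=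
    (algebraMap (MvPolynomial (Fin N) F) L).comp (MvPolynomial.map φ)
  have hχ : χ f.leadingCoeff ≠ 0 := (map_ne_zero_iff _ hinj).2 hlead
  obtain ⟨β, hβ⟩ := IsAlgClosed.exists_root (f.map χ) (by
    rw [Polynomial.degree_map_eq_of_leadingCoeff_ne_zero χ hχ]
    exact (Polynomial.natDegree_pos_iff_degree_pos.1 hdeg).ne')
  let w : ℕ → L := fun i =>
    if h : i < N then algebraMap (MvPolynomial (Fin N) F) L (.X ⟨i, h⟩) else β
  obtain ⟨δL, hC, hX⟩ := exists_derivation_of_formallyEtale_mvPolynomial δF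
    fun i : Fin N => w (i + 1)
  let j : F →+* L := (algebraMap (MvPolynomial (Fin N) F) L).comp MvPolynomial.C
  have hz : ∀ i ≤ N, δL^[i] (w 0) = w i := fun i hi => by
    induction i with
    | zero => rfl
    | succ i ih =>
      rw [Function.iterate_succ_apply', ih (Nat.le_of_succ_le hi), ← hX ⟨i, hi⟩]
      simp only [w]
      rw [dif_pos (Nat.lt_of_succ_le hi)]
  have hev : ∀ p : MvPolynomial (Fin N) R, MvPolynomial.eval₂ (j.comp φ) (fun i => δL^[i] (w 0))
      (MvPolynomial.rename Fin.val p) = χ p := fun p => by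
    induction p using MvPolynomial.induction_on with
    | C r => simp [j, χ]
    | add p q hp hq => simp [hp, hq]
    | mul_X p i hp =>
      rw [map_mul, MvPolynomial.eval₂_mul, hp, map_mul, MvPolynomial.rename_X,
        MvPolynomial.eval₂_X, hz _ i.2.le]
      simp [w, χ]
  refine ⟨L, inferInstance, δL, j, w 0, fun x => (hC x).symm, ?_, fun p hp => ?_⟩
  · have : ∀ g, MvPolynomial.eval₂ (j.comp φ) (fun i => δL^[i] (w 0)) (evalTop R N g) =
        g.eval₂ χ β := fun g => by
      induction g using Polynomial.induction_on' with
      | add p q hp hq => simp [hp, hq]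
      | monomial n a =>
        rw [← Polynomial.C_mul_X_pow_eq_monomial, map_mul, map_pow, evalTop_C, evalTop_X,
          MvPolynomial.eval₂_mul, MvPolynomial.eval₂_pow, MvPolynomial.eval₂_X, hev, hz N le_rfl]
        simp [w]
    rw [this, Polynomial.eval₂_eq_eval_map]
    exact hβ
  · rw [hev]
    exact (map_ne_zero_iff _ hinj).2 hp

theorem map_evalTop {A : Type*} [CommRing A] (ψ : MvPolynomial ℕ R →+* A) {N : ℕ}
    (g : Polynomial (MvPolynomial (Fin N) R)) :
    ψ (evalTop R N g) =
      g.eval₂ (ψ.comp (MvPolynomial.rename Fin.val).toRingHom) (ψ (.X N)) := by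
  rw [evalTop, Polynomial.coe_eval₂RingHom, Polynomial.hom_eval₂]

theorem charZero_of_ringHom_of_rat_algebra [Algebra ℚ R] {F : Type*} [CommRing F] [Nontrivial F]
    (φ : R →+* F) : CharZero F :=
  charZero_of_injective_ringHom (φ.comp (algebraMap ℚ R)).injective

variable {δ : Derivation ℤ R R} {D : Derivation ℤ (MvPolynomial ℕ R) (MvPolynomial ℕ R)}

/-- Local elimination of one differential unknown, near a prime differential ideal. -/
theorem exists_solvableOne_of_isPrime [Algebra ℚ R] (hC : ∀ r, D (.C r) = .C (δ r))
    (hX : ∀ i, D (.X i) = .X (i + 1)) (E : Finset (MvPolynomial ℕ R)) (G : MvPolynomial ℕ R)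
    (Q : Ideal (MvPolynomial ℕ R)) [Q.IsPrime] (hQ : ∀ g ∈ Q, D g ∈ Q) (hE : ∀ e ∈ E, e ∈ Q)
    (hG : G ∉ Q) :
    ∃ (E' : Finset R) (g : R), (∀ e ∈ E', .C e ∈ Q) ∧ .C g ∉ Q ∧
      ∀ (F : Type u) [Field F] (δF : Derivation ℤ F F) (φ : R →+* F),
        (∀ r, φ (δ r) = δF (φ r)) → (∀ e ∈ E', φ e = 0) → φ g ≠ 0 → SolvableOne δF φ E G := by
  classical
  let L := FractionRing (MvPolynomial ℕ R ⧸ Q)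
  let ψ : MvPolynomial ℕ R →+* L :=
    (algebraMap (MvPolynomial ℕ R ⧸ Q) L).comp (Ideal.Quotient.mk Q)
  have hψ : ∀ x, ψ x = 0 ↔ x ∈ Q := fun x => by
    rw [← Ideal.Quotient.eq_zero_iff_mem]
    exact map_eq_zero_iff (algebraMap (MvPolynomial ℕ R ⧸ Q) L) (IsFractionRing.injective _ _)
  let φ₀ : R →+* L := ψ.comp MvPolynomial.C
  have : CharZero L := charZero_of_ringHom_of_rat_algebra φ₀
  have hφψ : ∀ p, MvPolynomial.map φ₀ p = 0 → ψ p = 0 := fun p =>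
    MvPolynomial.map_eq_zero_of_map_eq_zero φ₀ ψ fun _ h => h
  suffices H : ∃ (W : Finset (MvPolynomial ℕ R)) (Y : MvPolynomial ℕ R),
      (∀ w ∈ W, MvPolynomial.map φ₀ w = 0) ∧ MvPolynomial.map φ₀ Y ≠ 0 ∧
      ∀ (F : Type u) [Field F] (δF : Derivation ℤ F F) (φ : R →+* F),
        (∀ r, φ (δ r) = δF (φ r)) → (∀ w ∈ W, MvPolynomial.map φ w = 0) →
        MvPolynomial.map φ Y ≠ 0 → SolvableOne δF φ E G by
    obtain ⟨W, Y, hW, hY, hsol⟩ := H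
    obtain ⟨E', g, hE', hg, hdet⟩ := exists_coefficients φ₀ W Y hW hY
    refine ⟨E', g, fun e he => (hψ _).1 (hE' e he), fun h => hg ((hψ _).2 h),
      fun F _ δF φ hφ hφE hφg => ?_⟩
    obtain ⟨h₁, h₂⟩ := hdet F φ hφE hφg
    exact hsol F δF φ hφ h₁ h₂
  by_cases hgen : ∀ p, ψ p = 0 → MvPolynomial.map φ₀ p = 0
  · refine ⟨E, G, fun e he => hgen e ((hψ e).2 (hE e he)), fun h => hG ((hψ G).1 (hφψ G h)),
      fun F _ δF φ _ hW hY => ?_⟩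
    have := charZero_of_ringHom_of_rat_algebra φ
    exact solvableOne_of_generic δF φ hW hY
  have hex : ∃ n, ∃ P : MvPolynomial (Fin n) R, ψ (MvPolynomial.rename Fin.val P) = 0 ∧
      MvPolynomial.map φ₀ P ≠ 0 := by
    push Not at hgen
    obtain ⟨p, hp, hp0⟩ := hgen
    obtain ⟨P, hPp⟩ := MvPolynomial.exists_rename_eq_of_vars_subset_range p
      (Fin.val : Fin (p.vars.sup id + 1) → ℕ) Fin.val_injective fun i hi => by
        have : i ≤ p.vars.sup id := Finset.le_sup (f := id) hi
        exact ⟨⟨i, by omega⟩, rfl⟩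
    refine ⟨_, P, by rwa [hPp], fun h => hp0 ?_⟩
    rw [← hPp, MvPolynomial.map_rename, h, map_zero]
  obtain ⟨n, ⟨P, hP, hP0⟩, hmin⟩ : ∃ n, (∃ P : MvPolynomial (Fin n) R,
      ψ (MvPolynomial.rename Fin.val P) = 0 ∧ MvPolynomial.map φ₀ P ≠ 0) ∧
      ∀ k < n, ∀ P : MvPolynomial (Fin k) R,
      ψ (MvPolynomial.rename Fin.val P) = 0 → MvPolynomial.map φ₀ P = 0 :=
    ⟨Nat.find hex, Nat.find_spec hex, fun k hk P h => by
      by_contra h0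
      exact Nat.find_min hex hk ⟨P, h, h0⟩⟩
  obtain _ | N := n
  · rw [MvPolynomial.eq_C_of_isEmpty P, MvPolynomial.rename_C] at hP
    rw [MvPolynomial.eq_C_of_isEmpty P, MvPolynomial.map_C] at hP0
    exact absurd hP fun h => hP0 ((congrArg MvPolynomial.C h).trans (map_zero _))
  replace hmin := hmin N N.lt_succ_self
  let ψB : MvPolynomial (Fin N) R →+* L := ψ.comp (MvPolynomial.rename Fin.val).toRingHom
  have hvan : ∀ w : Polynomial (MvPolynomial (Fin N) R), w.map ψB = 0 →
      MvPolynomial.map φ₀ (evalTop R N w) = 0 := fun w hw => by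
    refine Polynomial.map_eq_zero_of_forall_map_coeff_eq_zero
      ((MvPolynomial.map φ₀).comp (evalTop R N)) w fun i => ?_
    have : ψB (w.coeff i) = 0 := by rw [← Polynomial.coeff_map, hw, Polynomial.coeff_zero]
    rw [RingHom.comp_apply, evalTop_C, MvPolynomial.map_rename, hmin _ this, map_zero]
  obtain ⟨f₀, hf₀⟩ := rename_mem_range_evalTop P
  have hann : ∃ f : Polynomial (MvPolynomial (Fin N) R), f.map ψB ≠ 0 ∧
      f.eval₂ ψB (ψ (.X N)) = 0 := by
    refine ⟨f₀, fun h => hP0 ?_, ?_⟩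
    · have := hvan _ h
      rw [hf₀, MvPolynomial.map_rename] at this
      exact (map_eq_zero_iff _ (MvPolynomial.rename_injective _ Fin.val_injective)).1 this
    · rw [← map_evalTop, hf₀, hP]
  obtain ⟨f, hlead, hdeg, hf, hf', hdiv⟩ := exists_minimal_annihilator ψB _ hann
  choose t r hred using exists_separant_pow_mul_sub_mem (D := D) hC hX f
  have hfQ : evalTop R N f ∈ Q := by rw [← hψ, map_evalTop, hf]
  have hrψ : ∀ e, (r e).eval₂ ψB (ψ (.X N)) =
      f.derivative.eval₂ ψB (ψ (.X N)) ^ t e * ψ e := fun e => by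
    have := (hψ _).2 (hred e Q hQ hfQ)
    rw [map_sub, sub_eq_zero, map_mul, map_pow, map_evalTop, map_evalTop] at this
    exact this.symm
  have hH : (f.derivative * r G).eval₂ ψB (ψ (.X N)) ≠ 0 := by
    rw [Polynomial.eval₂_mul, hrψ]
    exact mul_ne_zero hf' (mul_ne_zero (pow_ne_zero _ hf') fun h => hG ((hψ G).1 h))
  obtain ⟨c, z, hc, hz⟩ := exists_cofactor ψB _ hann _ hH
  obtain ⟨cz, qz, hcz, hqz⟩ := hdiv _ hz
  have hdivE : ∀ e, ∃ d q, ψB d ≠ 0 ∧ (e ∈ Q → (Polynomial.C d * r e - q * f).map ψB = 0) := by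
    intro e
    by_cases he : e ∈ Q
    · obtain ⟨d, q, hd, hq⟩ := hdiv (r e) (by rw [hrψ, (hψ e).2 he, mul_zero])
      exact ⟨d, q, hd, fun _ => hq⟩
    · exact ⟨1, 0, by simp, fun h => absurd h he⟩
  choose d q hd hq using hdivE
  refine ⟨insert (evalTop R N (.C cz * (.C c + f.derivative * r G * z) - qz * f))
    (E.image fun e => evalTop R N (.C (d e) * r e - q e * f)),
    MvPolynomial.rename Fin.val (f.leadingCoeff * (cz * (c * ∏ e ∈ E, d e))), ?_, ?_, ?_⟩
  · simp only [Finset.forall_mem_insert, Finset.forall_mem_image]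
    exact ⟨hvan _ hqz, fun e he => hvan _ (hq e (hE e he))⟩
  · refine fun h => ?_
    have := hφψ _ h
    change ψB _ = 0 at this
    simp only [map_mul, map_prod, mul_eq_zero, hlead, hcz, hc, false_or] at this
    exact Finset.prod_ne_zero_iff.2 (fun e _ => hd e) this
  intro F _ δF φ hφ hW hY
  have := charZero_of_ringHom_of_rat_algebra φ
  simp only [Finset.forall_mem_insert, Finset.forall_mem_image] at hW
  rw [MvPolynomial.map_rename] at hY
  replace hY := ne_zero_of_map hY
  simp only [map_mul, map_prod, mul_ne_zero_iff, Finset.prod_ne_zero_iff] at hY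
  obtain ⟨hYl, hYz, hYc, hYd⟩ := hY
  obtain ⟨M, _, δM, j, w, hj, hfw, hgen'⟩ := exists_generic_zero δF φ f hdeg hYl
  let ψ' : MvPolynomial ℕ R →+* M := MvPolynomial.eval₂Hom (j.comp φ) fun i => δM^[i] w
  change ψ' (evalTop R N f) = 0 at hfw
  change ∀ p, _ → ψ' _ ≠ 0 at hgen'
  have hψφ : ∀ p, MvPolynomial.map φ p = 0 → ψ' p = 0 := fun p =>
    MvPolynomial.map_eq_zero_of_map_eq_zero φ ψ' fun x hx => by simp [ψ', hx]
  have hψ'D : ∀ p, ψ' (D p) = δM (ψ' p) := by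
    refine map_derivation_mvPolynomial (fun x => ?_) fun i => ?_
    · simp [ψ', hC, hφ, hj]
    · simp [ψ', hX, Function.iterate_succ_apply']
  have hker : ∀ e, ψ' (evalTop R N f.derivative) ^ t e * ψ' e = ψ' (evalTop R N (r e)) :=
    fun e => by
      have := hred e (RingHom.ker ψ') (fun g hg => by
        rw [RingHom.mem_ker] at hg ⊢
        rw [hψ'D, hg, map_zero]) hfw
      rwa [RingHom.mem_ker, map_sub, sub_eq_zero, map_mul, map_pow] at this
  have hcancel : ∀ a b c, ψ' (MvPolynomial.rename Fin.val a) ≠ 0 →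
      MvPolynomial.map φ (evalTop R N (.C a * b - c * f)) = 0 → ψ' (evalTop R N b) = 0 := by
    intro a b c ha h
    have := hψφ _ h
    simp only [map_sub, map_mul, hfw, mul_zero, sub_zero, evalTop_C, mul_eq_zero, ha,
      false_or] at this
    exact this
  have hZ := hcancel _ _ _ (hgen' _ hYz) hW.1
  have hHne : ψ' (evalTop R N f.derivative) ≠ 0 ∧ ψ' (evalTop R N (r G)) ≠ 0 := by
    rw [← not_or, ← mul_eq_zero]
    intro h0
    rw [map_add, map_add, map_mul, map_mul, map_mul, map_mul, h0, zero_mul, add_zero,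
      evalTop_C] at hZ
    exact hgen' _ hYc hZ
  refine ⟨M, inferInstance, δM, j, w, hj, fun e he => ?_, fun h => hHne.2 ?_⟩
  · have h := hcancel _ _ _ (hgen' _ (hYd e he)) (hW.2 he)
    rw [← hker, mul_eq_zero] at h
    exact h.resolve_left (pow_ne_zero _ hHne.1)
  · rw [← hker]
    exact mul_eq_zero_of_right _ h

end LocalElimination

theorem PrimeSpectrum.isClopen_setOf_mem {S : Type*} [CommRing S] (f : S) :
    IsClopen {x : WithConstructibleTopology (PrimeSpectrum S) | f ∈ x.ofTopology.asIdeal} := by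
  have hcl : IsClosed {x : PrimeSpectrum S | f ∈ x.asIdeal} := by
    simpa [PrimeSpectrum.zeroLocus, Set.singleton_subset_iff] using
      PrimeSpectrum.isClosed_zeroLocus {f}
  have hco : IsCompact {x : PrimeSpectrum S | f ∈ x.asIdeal}ᶜ :=
    PrimeSpectrum.isCompact_basicOpen f
  refine ⟨⟨?_⟩, ?_⟩
  · rw [WithConstructibleTopology.isOpen_iff]
    exact hco.isOpen_constructibleTopology_of_isOpen hcl.isOpen_compl
  · rw [WithConstructibleTopology.isOpen_iff]
    exact hco.isOpen_constructibleTopology_of_isClosed hcl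

/-- Elimination of one differential unknown. -/
theorem exists_solvableOne_iff {R : Type u} [CommRing R] [Algebra ℚ R] {δ : Derivation ℤ R R}
    {D : Derivation ℤ (MvPolynomial ℕ R) (MvPolynomial ℕ R)} (hC : ∀ r, D (.C r) = .C (δ r))
    (hX : ∀ i, D (.X i) = .X (i + 1)) (E : Finset (MvPolynomial ℕ R)) (G : MvPolynomial ℕ R) :
    ∃ Θ : Finset (Finset R × R),
      ∀ (F : Type u) [Field F] (δF : Derivation ℤ F F) (φ : R →+* F),
        (∀ r, φ (δ r) = δF (φ r)) →
        (SolvableOne δF φ E G ↔ ∃ θ ∈ Θ, (∀ e ∈ θ.1, φ e = 0) ∧ φ θ.2 ≠ 0) := by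
  let X := WithConstructibleTopology (PrimeSpectrum (MvPolynomial ℕ R))
  let T : Set X := (⋂ g, {x | g ∈ x.ofTopology.asIdeal → D g ∈ x.ofTopology.asIdeal}) ∩
    ((⋂ e ∈ E, {x | e ∈ x.ofTopology.asIdeal}) ∩ {x | G ∈ x.ofTopology.asIdeal}ᶜ)
  have hT : IsClosed T := by
    refine IsClosed.inter (isClosed_iInter fun g => ?_) (IsClosed.inter
      (isClosed_biInter fun e _ => (PrimeSpectrum.isClopen_setOf_mem e).isClosed)
      (PrimeSpectrum.isClopen_setOf_mem G).compl.isClosed)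
    simp only [imp_iff_not_or]
    exact (PrimeSpectrum.isClopen_setOf_mem g).compl.isClosed.union
      (PrimeSpectrum.isClopen_setOf_mem (D g)).isClosed
  let I := {θ : Finset R × R // ∀ (F : Type u) [Field F] (δF : Derivation ℤ F F) (φ : R →+* F),
    (∀ r, φ (δ r) = δF (φ r)) → (∀ e ∈ θ.1, φ e = 0) → φ θ.2 ≠ 0 → SolvableOne δF φ E G}
  let U : I → Set X := fun θ => (⋂ e ∈ θ.1.1, {x | .C e ∈ x.ofTopology.asIdeal}) ∩
    {x | .C θ.1.2 ∈ x.ofTopology.asIdeal}ᶜ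
  have hU : ∀ θ, IsOpen (U θ) := fun θ =>
    IsOpen.inter (isOpen_biInter_finset fun e _ => (PrimeSpectrum.isClopen_setOf_mem _).isOpen)
      (PrimeSpectrum.isClopen_setOf_mem _).compl.isOpen
  have hTU : T ⊆ ⋃ θ, U θ := by
    rintro x ⟨h₁, h₂, h₃⟩
    obtain ⟨E', g, hE', hg, hsol⟩ :=
      exists_solvableOne_of_isPrime hC hX E G x.ofTopology.asIdeal
        (Set.mem_iInter.1 h₁) (Set.mem_iInter₂.1 h₂) h₃
    refine Set.mem_iUnion.2 ⟨⟨(E', g), hsol⟩, Set.mem_iInter₂.2 hE', hg⟩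
  obtain ⟨Θ, hΘ⟩ := hT.isCompact.elim_finite_subcover U hU hTU
  refine ⟨Θ.map (Function.Embedding.subtype _), fun F _ δF φ hφ => ⟨?_, ?_⟩⟩
  · rintro ⟨L, _, δL, j, z, hj, hz, hzG⟩
    let ψ : MvPolynomial ℕ R →+* L := MvPolynomial.eval₂Hom (j.comp φ) fun i => δL^[i] z
    have hψD : ∀ p, ψ (D p) = δL (ψ p) := by
      refine map_derivation_mvPolynomial (fun x => ?_) fun i => ?_
      · simp [ψ, hC, hφ, hj]
      · simp [ψ, hX, Function.iterate_succ_apply']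
    have hψC : ∀ r, ψ (.C r) = 0 ↔ φ r = 0 := fun r => by simp [ψ]
    have hmem : WithTopology.toTopology _ ⟨RingHom.ker ψ, RingHom.ker_isPrime ψ⟩ ∈ T := by
      refine ⟨Set.mem_iInter.2 fun g (hg : ψ g = 0) => ?_, Set.mem_iInter₂.2 hz, hzG⟩
      change ψ _ = 0
      rw [hψD, hg, map_zero]
    obtain ⟨θ, hθ, h₁, h₂⟩ := Set.mem_iUnion₂.1 (hΘ hmem)
    refine ⟨θ.1, Finset.mem_map_of_mem _ hθ, fun e he => ?_, fun h => h₂ ((hψC _).2 h)⟩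
    exact (hψC _).1 (Set.mem_iInter₂.1 h₁ e he)
  · rintro ⟨θ, hθ, h₁, h₂⟩
    obtain ⟨θ, -, rfl⟩ := Finset.mem_map.1 hθ
    exact θ.2 F δF φ hφ h₁ h₂

section Elimination

/-- A derivation in the sense of `IsDerivationFn`, as a bundled derivation. -/
def IsDerivationFn.toDerivation {R : Type*} [CommRing R] {δ : R → R} (hδ : IsDerivationFn δ) :
    Derivation ℤ R R :=
  Derivation.mk' (AddMonoidHom.mk' δ hδ.1).toIntLinearMap hδ.2

theorem Derivation.isDerivationFn {R : Type*} [CommRing R] (D : Derivation ℤ R R) :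
    IsDerivationFn D :=
  ⟨map_add D, D.leibniz⟩

/-- A derivation on `R` extends to differential polynomials over `R`. -/
theorem exists_isDerivationFn_mvPolynomial {R σ : Type*} [CommRing R] {δ : R → R}
    (hδ : IsDerivationFn δ) :
    ∃ D : MvPolynomial (σ × ℕ) R → MvPolynomial (σ × ℕ) R, IsDerivationFn D ∧
      (∀ r, D (.C r) = .C (δ r)) ∧ ∀ p, D (.X p) = .X (p.1, p.2 + 1) := by
  obtain ⟨D, hC, hX⟩ := exists_derivation_mvPolynomial (A := MvPolynomial (σ × ℕ) R)
    hδ.toDerivation fun p : σ × ℕ => .X (p.1, p.2 + 1)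
  exact ⟨D, ⟨D.map_add, D.leibniz⟩, hC, hX⟩

theorem IsDerivationFn.map_eq_of_mvPolynomial {R A σ : Type*} [CommRing R] [CommRing A]
    {D : MvPolynomial σ R → MvPolynomial σ R} (hD : IsDerivationFn D) {δ : A → A}
    (hδ : IsDerivationFn δ) {φ : MvPolynomial σ R →+* A}
    (hC : ∀ r, φ (D (.C r)) = δ (φ (.C r))) (hX : ∀ i, φ (D (.X i)) = δ (φ (.X i))) (p) :
    φ (D p) = δ (φ p) := by
  induction p using MvPolynomial.induction_on with
  | C r => exact hC r
  | add p q hp hq => rw [hD.1, map_add, map_add, hδ.1, hp, hq]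
  | mul_X p i hp => simp only [hD.2, map_add, map_mul, hδ.2, hp, hX]

theorem map_iterate_of_map {A B : Type*} {δA : A → A} {δB : B → B} {j : A → B}
    (hj : ∀ x, j (δA x) = δB (j x)) (k : ℕ) (x : A) : j (δA^[k] x) = δB^[k] (j x) :=
  Function.Semiconj.iterate_right (f := j) hj k x

/-- Evaluation of differential polynomials, as a ring homomorphism. -/
noncomputable def devalHom {K L : Type*} [CommRing K] [CommRing L] (ι : K →+* L) (δ : L → L)
    {σ : Type*} (a : σ → L) : MvPolynomial (σ × ℕ) K →+* L :=
  MvPolynomial.eval₂Hom ι fun p => δ^[p.2] (a p.1)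

theorem devalHom_C {K L : Type*} [CommRing K] [CommRing L] (ι : K →+* L) (δ : L → L)
    {σ : Type*} (a : σ → L) (r : K) : devalHom ι δ a (.C r) = ι r :=
  MvPolynomial.eval₂_C _ _ _

theorem devalHom_X {K L : Type*} [CommRing K] [CommRing L] (ι : K →+* L) (δ : L → L)
    {σ : Type*} (a : σ → L) (p : σ × ℕ) : devalHom ι δ a (.X p) = δ^[p.2] (a p.1) :=
  MvPolynomial.eval₂_X _ _ _

theorem devalHom_derivation {K L σ : Type*} [CommRing K] [CommRing L] {ι : K →+* L} {δ : K → K}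
    {δL : L → L} (hδL : IsDerivationFn δL) (hι : ∀ x, ι (δ x) = δL (ι x))
    {D : MvPolynomial (σ × ℕ) K → MvPolynomial (σ × ℕ) K} (hD : IsDerivationFn D)
    (hC : ∀ r, D (.C r) = .C (δ r)) (hX : ∀ p, D (.X p) = .X (p.1, p.2 + 1)) (a : σ → L)
    (p : MvPolynomial (σ × ℕ) K) : devalHom ι δL a (D p) = δL (devalHom ι δL a p) := by
  refine hD.map_eq_of_mvPolynomial hδL (fun r => ?_) (fun i => ?_) p
  · rw [hC, devalHom_C, devalHom_C, hι]
  · rw [hX, devalHom_X, devalHom_X, Function.iterate_succ_apply']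

/-- The system `E = 0`, `G ≠ 0` in `n` differential unknowns, with coefficients specialized by `φ`,
is solvable in some differential field extension of `F`. -/
def SolvableSystem {R F : Type u} [CommRing R] [Field F] (δF : F → F) (φ : R →+* F) {n : ℕ}
    (E : Finset (MvPolynomial (Fin n × ℕ) R)) (G : MvPolynomial (Fin n × ℕ) R) : Prop :=
  ∃ (L : Type u) (_ : Field L) (j : F →+* L) (δL : L → L),
    IsDerivationFn δL ∧ (∀ x, j (δF x) = δL (j x)) ∧
    ∃ b : Fin n → L, (∀ e ∈ E, devalHom (j.comp φ) δL b e = 0) ∧ devalHom (j.comp φ) δL b G ≠ 0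

theorem exists_solvableOne_iff_of_isDerivationFn {R : Type u} [CommRing R] [Algebra ℚ R]
    {δ : R → R} (hδ : IsDerivationFn δ) (E : Finset (MvPolynomial ℕ R)) (G : MvPolynomial ℕ R) :
    ∃ Θ : Finset (Finset R × R),
      ∀ (F : Type u) [Field F] (δF : Derivation ℤ F F) (φ : R →+* F),
        (∀ r, φ (δ r) = δF (φ r)) →
        (SolvableOne δF φ E G ↔ ∃ θ ∈ Θ, (∀ e ∈ θ.1, φ e = 0) ∧ φ θ.2 ≠ 0) := by
  obtain ⟨D, hC, hX⟩ := exists_derivation_mvPolynomial (A := MvPolynomial ℕ R)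
    hδ.toDerivation fun i => .X (i + 1)
  exact exists_solvableOne_iff hC hX E G

/-- View a differential polynomial in `n + 1` unknowns as a differential polynomial in the first
unknown. -/
noncomputable def splitFirst (R : Type*) [CommRing R] (n : ℕ) :
    MvPolynomial (Fin (n + 1) × ℕ) R →+* MvPolynomial ℕ (MvPolynomial (Fin n × ℕ) R) :=
  MvPolynomial.eval₂Hom (MvPolynomial.C.comp MvPolynomial.C) fun p =>
    (Fin.cons (.X p.2) fun i => .C (.X (i, p.2)) :
      Fin (n + 1) → MvPolynomial ℕ (MvPolynomial (Fin n × ℕ) R)) p.1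

theorem eval₂_splitFirst {R L M : Type*} [CommRing R] [CommRing L] [CommRing M] {n : ℕ}
    (ι : R →+* L) {δL : L → L} {δM : M → M} (j : L →+* M) (hj : ∀ x, j (δL x) = δM (j x))
    (z : M) (b : Fin n → L) (p : MvPolynomial (Fin (n + 1) × ℕ) R) :
    MvPolynomial.eval₂ (j.comp (devalHom ι δL b)) (fun i => δM^[i] z) (splitFirst R n p) =
      devalHom (j.comp ι) δM (Fin.cons z (j ∘ b) : Fin (n + 1) → M) p := by
  rw [← MvPolynomial.coe_eval₂Hom, ← RingHom.comp_apply]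
  congr 1
  refine MvPolynomial.ringHom_ext (fun r => ?_) fun ⟨i, k⟩ => ?_
  · simp [splitFirst, devalHom_C]
  · rw [devalHom_X]
    refine Fin.cases ?_ (fun i => ?_) i
    · simp [splitFirst]
    · simp [splitFirst, devalHom_X, map_iterate_of_map hj]

/-- Elimination of finitely many differential unknowns. -/
theorem exists_solvableSystem_iff {n : ℕ} : ∀ {R : Type u} [CommRing R] [Algebra ℚ R] {δ : R → R},
    IsDerivationFn δ → ∀ (E : Finset (MvPolynomial (Fin n × ℕ) R))
    (G : MvPolynomial (Fin n × ℕ) R),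
    ∃ Θ : Finset (Finset R × R), ∀ (F : Type u) [Field F] (δF : F → F) (φ : R →+* F),
      IsDerivationFn δF → (∀ r, φ (δ r) = δF (φ r)) →
      (SolvableSystem δF φ E G ↔ ∃ θ ∈ Θ, (∀ e ∈ θ.1, φ e = 0) ∧ φ θ.2 ≠ 0) := by
  classical
  induction n with
  | zero =>
    intro R _ _ δ hδ E G
    have hev : ∀ {L : Type u} [Field L] (ι : R →+* L) (δL : L → L) (b : Fin 0 → L) p,
        devalHom ι δL b p = ι (p.coeff 0) := fun ι δL b p => by
      conv_lhs => rw [MvPolynomial.eq_C_of_isEmpty p, devalHom_C]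
    refine ⟨{(E.image fun e => e.coeff 0, G.coeff 0)}, fun F _ δF φ hδF hφ => ?_⟩
    simp only [SolvableSystem, Finset.mem_singleton, exists_eq_left, Finset.forall_mem_image, hev]
    constructor
    · rintro ⟨L, _, j, δL, -, -, -, hE, hG⟩
      exact ⟨fun e he => (map_eq_zero j).1 (hE e he), (map_ne_zero j).1 hG⟩
    · rintro ⟨hE, hG⟩
      exact ⟨F, inferInstance, .id F, δF, hδF, fun _ => rfl, Fin.elim0, fun e he => hE he, hG⟩
  | succ n ih =>
    intro R _ _ δ hδ E G
    obtain ⟨D, hD, hDC, hDX⟩ := exists_isDerivationFn_mvPolynomial (σ := Fin n) hδ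
    obtain ⟨Θ₁, hΘ₁⟩ := exists_solvableOne_iff_of_isDerivationFn hD
      (E.image (splitFirst R n)) (splitFirst R n G)
    choose Θ hΘ using fun θ : Finset (MvPolynomial (Fin n × ℕ) R) × MvPolynomial (Fin n × ℕ) R =>
      ih hδ θ.1 θ.2
    refine ⟨Θ₁.biUnion Θ, fun F _ δF φ hδF hφ => ?_⟩
    have key : SolvableSystem δF φ E G ↔ ∃ θ ∈ Θ₁, SolvableSystem δF φ θ.1 θ.2 := by
      constructor
      · rintro ⟨L, _, j, δL, hδL, hj, b, hE, hG⟩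
        obtain ⟨θ, hθ, h₁, h₂⟩ := (hΘ₁ L hδL.toDerivation (devalHom (j.comp φ) δL (Fin.tail b))
          (devalHom_derivation hδL (fun x => by simp [hφ, hj]) hD hDC hDX _)).1
          ⟨L, inferInstance, hδL.toDerivation, .id L, b 0, fun _ => rfl, by
            have := eval₂_splitFirst (j.comp φ) (RingHom.id L) (δL := δL) (δM := δL)
              (fun _ => rfl) (b 0) (Fin.tail b)
            simp only [Finset.forall_mem_image]
            refine ⟨fun e he => (this e).trans ?_,
              fun h => hG (Eq.trans ?_ ((this G).symm.trans h))⟩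
            · exact (congrArg (devalHom _ δL · e) (Fin.cons_self_tail b)).trans (hE e he)
            · exact (congrArg (devalHom _ δL · G) (Fin.cons_self_tail b)).symm⟩
        exact ⟨θ, hθ, L, inferInstance, j, δL, hδL, hj, _, h₁, h₂⟩
      · rintro ⟨θ, hθ, L, _, j, δL, hδL, hj, b, h₁, h₂⟩
        obtain ⟨M, _, δM, i, z, hi, hE, hG⟩ := (hΘ₁ L hδL.toDerivation (devalHom (j.comp φ) δL b)
          (devalHom_derivation hδL (fun x => by simp [hφ, hj]) hD hDC hDX _)).2 ⟨θ, hθ, h₁, h₂⟩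
        have := eval₂_splitFirst (j.comp φ) i (δL := δL) (δM := δM) hi z b
        refine ⟨M, inferInstance, i.comp j, δM, δM.isDerivationFn, fun x => ?_,
          Fin.cons z (i ∘ b), fun e he => ?_, fun h => hG ((this G).trans h)⟩
        · rw [RingHom.comp_apply, hj]
          exact hi _
        · exact (this e).symm.trans (hE _ (Finset.mem_image_of_mem _ he))
    rw [key]
    simp only [Finset.mem_biUnion, fun θ => hΘ θ F δF φ hδF hφ]
    exact ⟨fun ⟨θ, h, θ', h', h''⟩ => ⟨θ', ⟨θ, h, h'⟩, h''⟩,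
      fun ⟨θ', ⟨θ, h, h'⟩, h''⟩ => ⟨θ, h, θ', h', h''⟩⟩

end Elimination

open Topology

section Constructible

theorem IsConstructibleIn.of_mem_closure {α : Type*} (t : TopologicalSpace α) {S : Set α}
    (hS : S ∈ BooleanSubalgebra.closure {C | IsClosed[t] C}) : IsConstructibleIn t S := by
  have hsub : IsSublattice {C : Set α | IsClosed[t] C} :=
    ⟨fun _ h _ h' => @IsClosed.union _ _ _ t h h', fun _ h _ h' => @IsClosed.inter _ _ _ t h h'⟩
  obtain ⟨T, rfl⟩ := (BooleanSubalgebra.mem_closure_iff_sup_sdiff hsub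
    (@isClosed_empty _ t) (@isClosed_univ _ t)).1 hS
  refine ⟨T.card, fun i => (T.equivFin.symm i).1.1, fun i => (T.equivFin.symm i).1.2,
    fun i => (T.equivFin.symm i).1.1.2, fun i => (T.equivFin.symm i).1.2.2, ?_⟩
  rw [Finset.sup_eq_iSup, iSup_subtype', ← T.equivFin.symm.iSup_comp]
  rfl

theorem BooleanSubalgebra.iUnion_mem {α ι : Type*} [Finite ι] (L : BooleanSubalgebra (Set α))
    {f : ι → Set α} (hf : ∀ i, f i ∈ L) : ⋃ i, f i ∈ L :=
  L.supClosed.iSup_mem L.bot_mem hf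

end Constructible

section Parameters

theorem exists_isDerivationFn_of_formallyEtale {P : Type*} (F : Type*) [CommRing P] [CommRing F]
    [Algebra P F] [Algebra.FormallyEtale P F] {D : P → P} (hD : IsDerivationFn D) :
    ∃ δF : F → F, IsDerivationFn δF ∧
      ∀ x, δF (algebraMap P F x) = algebraMap P F (D x) := by
  obtain ⟨δF, hδF⟩ := exists_derivation_of_formallyEtale
    ((Algebra.linearMap P F).compDer hD.toDerivation)
  exact ⟨δF, δF.isDerivationFn, hδF⟩

/-- A derivation of a domain extends to its field of fractions, universally. -/
theorem exists_differential_fractionField (P : Type u) [CommRing P] [IsDomain P] {D : P → P}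
    (hD : IsDerivationFn D) :
    ∃ (F : Type u) (_ : Field F) (ι : P →+* F) (δF : F → F), Function.Injective ι ∧
      IsDerivationFn δF ∧ (∀ x, ι (D x) = δF (ι x)) ∧
      ∀ (L : Type u) [Field L] (δL : L → L) (χ : P →+* L), IsDerivationFn δL →
        Function.Injective χ → (∀ x, χ (D x) = δL (χ x)) →
        ∃ χ' : F →+* L, χ'.comp ι = χ ∧ ∀ x, χ' (δF x) = δL (χ' x) := by
  have := Algebra.FormallyEtale.of_isLocalization (Rₘ := FractionRing P) (nonZeroDivisors P)
  obtain ⟨δF, hder, hδF⟩ := exists_isDerivationFn_of_formallyEtale (FractionRing P) hD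
  refine ⟨FractionRing P, inferInstance, algebraMap P (FractionRing P), δF,
    IsFractionRing.injective _ _, hder, fun x => (hδF x).symm,
    fun L _ δL χ hδL hχ hχD => ⟨IsFractionRing.lift hχ, ?_, fun x => ?_⟩⟩
  · ext x
    simp
  · obtain ⟨a, b, hb, rfl⟩ := IsFractionRing.div_surjective (A := P) x
    have hb0 : algebraMap P (FractionRing P) b ≠ 0 :=
      IsFractionRing.to_map_ne_zero_of_mem_nonZeroDivisors hb
    set y := algebraMap P (FractionRing P) a / algebraMap P (FractionRing P) b with hy
    have hby : algebraMap P (FractionRing P) b * y = algebraMap P (FractionRing P) a :=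
      mul_div_cancel₀ _ hb0
    have hχb : χ b ≠ 0 := (map_ne_zero_iff χ hχ).2 (nonZeroDivisors.ne_zero hb)
    have h₁ := congrArg (IsFractionRing.lift hχ) (congrArg δF hby)
    have h₂ := congrArg δL (congrArg (IsFractionRing.lift hχ) hby)
    rw [hder.2, hδF, hδF, map_add, map_mul, map_mul,
      IsFractionRing.lift_algebraMap, IsFractionRing.lift_algebraMap,
      IsFractionRing.lift_algebraMap] at h₁
    rw [map_mul, hδL.2, IsFractionRing.lift_algebraMap, IsFractionRing.lift_algebraMap,
      ← hχD a, ← h₁, hχD b] at h₂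
    exact (mul_left_cancel₀ hχb (add_right_cancel h₂)).symm

variable {K : Type u} [Field K] {σ τ : Type*}

/-- View differential polynomials in the parameters `σ` and the unknowns `τ` as differential
polynomials in the unknowns. -/
noncomputable def splitParams (K : Type*) [CommRing K] (σ τ : Type*) :
    MvPolynomial ((σ ⊕ τ) × ℕ) K →+* MvPolynomial (τ × ℕ) (MvPolynomial (σ × ℕ) K) :=
  MvPolynomial.eval₂Hom (MvPolynomial.C.comp MvPolynomial.C) fun p =>
    p.1.elim (fun i => .C (.X (i, p.2))) fun i => .X (i, p.2)

/-- Specialization of the parameters. -/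
noncomputable def specialize (δ : K → K) (a : σ → K) :
    MvPolynomial ((σ ⊕ τ) × ℕ) K →+* MvPolynomial (τ × ℕ) K :=
  (MvPolynomial.map (devalHom (.id K) δ a)).comp (splitParams K σ τ)

theorem specialize_C (δ : K → K) (a : σ → K) (r : K) :
    specialize (τ := τ) δ a (.C r) = .C r := by
  simp [specialize, splitParams, devalHom_C]

theorem specialize_X_inl (δ : K → K) (a : σ → K) (i : σ) (k : ℕ) :
    specialize (τ := τ) δ a (.X (.inl i, k)) = .C (δ^[k] (a i)) := by
  simp [specialize, splitParams, devalHom_X]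

theorem specialize_X_inr (δ : K → K) (a : σ → K) (i : τ) (k : ℕ) :
    specialize δ a (.X (.inr i, k)) = .X (i, k) := by
  simp [specialize, splitParams]

theorem isClosed_setOf_specialize_eq_zero (δ : K → K) (e : MvPolynomial ((σ ⊕ τ) × ℕ) K) :
    IsClosed[kolchinTopology K δ σ] {a | specialize δ a e = 0} := by
  have : {a | specialize δ a e = 0} =
      ⋂ i, {a | devalMap (.id K) δ ((splitParams K σ τ e).coeff i) a ≠ 0}ᶜ := by
    ext a
    simp only [Set.mem_iInter, Set.mem_compl_iff, Set.mem_ofPred_eq, not_not]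
    rw [MvPolynomial.ext_iff]
    refine forall_congr' fun i => ?_
    rw [specialize, RingHom.comp_apply, MvPolynomial.coeff_map, MvPolynomial.coeff_zero]
    rfl
  rw [this]
  let := kolchinTopology K δ σ
  refine isClosed_iInter fun i => IsOpen.isClosed_compl ?_
  exact TopologicalSpace.isOpen_generateFrom_of_mem ⟨_, rfl⟩

theorem specialize_derivation {δ : K → K}
    {D₀ : MvPolynomial ((σ ⊕ τ) × ℕ) K → MvPolynomial ((σ ⊕ τ) × ℕ) K} (hD₀ : IsDerivationFn D₀)
    (hC₀ : ∀ r, D₀ (.C r) = .C (δ r)) (hX₀ : ∀ p, D₀ (.X p) = .X (p.1, p.2 + 1))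
    {D : MvPolynomial (τ × ℕ) K → MvPolynomial (τ × ℕ) K} (hD : IsDerivationFn D)
    (hC : ∀ r, D (.C r) = .C (δ r)) (hX : ∀ p, D (.X p) = .X (p.1, p.2 + 1)) (a : σ → K) (p) :
    specialize δ a (D₀ p) = D (specialize δ a p) := by
  refine hD₀.map_eq_of_mvPolynomial hD (fun r => ?_) (fun ⟨i, k⟩ => ?_) p
  · rw [hC₀, specialize_C, specialize_C, hC]
  · rw [hX₀]
    obtain i | i := i
    · rw [specialize_X_inl, specialize_X_inl, hC, Function.iterate_succ_apply']
    · rw [specialize_X_inr, specialize_X_inr, hX]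

theorem devalHom_map_rename_splitParams {υ L : Type*} [Field L] {δ : K → K} {δL : L → L}
    (j : MvPolynomial (υ × ℕ) K →+* L) (hj : ∀ x, j (.C (δ x)) = δL (j (.C x))) (a : σ → K)
    (b : τ → L) (p : MvPolynomial ((σ ⊕ τ) × ℕ) K) :
    devalHom (j.comp (specialize δ a)) δL b (MvPolynomial.map
        (MvPolynomial.rename (Prod.map Sum.inl id)).toRingHom (splitParams K σ τ p)) =
      devalHom (j.comp MvPolynomial.C) δL (Sum.elim (fun i => j (.C (a i))) b) p := by
  have : (devalHom (j.comp (specialize δ a)) δL b).comp ((MvPolynomial.map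
      (MvPolynomial.rename (Prod.map Sum.inl id)).toRingHom).comp (splitParams K σ τ)) =
      devalHom (j.comp MvPolynomial.C) δL (Sum.elim (fun i => j (.C (a i))) b) := by
    refine MvPolynomial.ringHom_ext (fun r => ?_) fun ⟨i, k⟩ => ?_
    · simp [splitParams, devalHom_C, specialize_C]
    · rw [devalHom_X]
      obtain i | i := i
      · simp [splitParams, devalHom_C, specialize_X_inl,
          map_iterate_of_map (j := fun x => j (.C x)) hj]
      · simp [splitParams, devalHom_X]
  exact RingHom.congr_fun this p

end Parameters

section DifferentialDimension

variable {K : Type u} [Field K]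

/-- The parameters for which a system in disjunctive normal form with a single disjunct has a
solution with the coordinates selected by `s` differentially independent form a constructible
set. -/
theorem setOf_exists_independent_solution_mem_closure [CharZero K] {δ : K → K}
    (hδ : IsDerivationFn δ) {m n q r d : ℕ} (E : Fin q → MvPolynomial ((Fin m ⊕ Fin n) × ℕ) K)
    (G : Fin r → MvPolynomial ((Fin m ⊕ Fin n) × ℕ) K) (s : Fin d → Fin n) :
    {a : Fin m → K | ∃ (L : Type u) (_ : Field L) (ι : K →+* L) (δL : L → L),
      IsDerivationFn δL ∧ (∀ x, ι (δ x) = δL (ι x)) ∧ ∃ b : Fin n → L,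
        ((∀ i, devalMap ι δL (E i) (Sum.elim (fun i => ι (a i)) b) = 0) ∧
          ∀ j, devalMap ι δL (G j) (Sum.elim (fun i => ι (a i)) b) ≠ 0) ∧
        ∀ f : MvPolynomial (Fin d × ℕ) K,
          MvPolynomial.eval₂ ι (fun pr => δL^[pr.2] (b (s pr.1))) f = 0 → f = 0} ∈
      BooleanSubalgebra.closure {C | IsClosed[kolchinTopology K δ (Fin m)] C} := by
  classical
  obtain ⟨D₀, hD₀, hC₀, hX₀⟩ := exists_isDerivationFn_mvPolynomial (σ := Fin m ⊕ Fin d) hδ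
  obtain ⟨D, hD, hC, hX⟩ := exists_isDerivationFn_mvPolynomial (σ := Fin d) hδ
  obtain ⟨F, _, ι, δF, hι, hδF, hιD, hlift⟩ := exists_differential_fractionField _ hD
  let τ : MvPolynomial ((Fin m ⊕ Fin n) × ℕ) K →+*
      MvPolynomial (Fin n × ℕ) (MvPolynomial ((Fin m ⊕ Fin d) × ℕ) K) :=
    (MvPolynomial.map (MvPolynomial.rename (Prod.map Sum.inl id)).toRingHom).comp
      (splitParams K (Fin m) (Fin n))
  obtain ⟨Θ, hΘ⟩ := exists_solvableSystem_iff hD₀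
    (Finset.univ.image (fun i => τ (E i)) ∪
      Finset.univ.image fun l => .X (s l, 0) - .C (.X (.inr l, 0))) (∏ i, τ (G i))
  have hDiter : ∀ (k : ℕ) (l : Fin d), D^[k] (.X (l, 0)) = .X (l, k) := fun k l => by
    induction k with
    | zero => rfl
    | succ k ih => rw [Function.iterate_succ_apply', ih, hX]
  have hιC : ∀ x, ι (.C (δ x)) = δF (ι (.C x)) := fun x => by rw [← hC, hιD]
  have key : ∀ a : Fin m → K, (∃ (L : Type u) (_ : Field L) (ι : K →+* L) (δL : L → L),
      IsDerivationFn δL ∧ (∀ x, ι (δ x) = δL (ι x)) ∧ ∃ b : Fin n → L,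
        ((∀ i, devalMap ι δL (E i) (Sum.elim (fun i => ι (a i)) b) = 0) ∧
          ∀ j, devalMap ι δL (G j) (Sum.elim (fun i => ι (a i)) b) ≠ 0) ∧
        ∀ f : MvPolynomial (Fin d × ℕ) K,
          MvPolynomial.eval₂ ι (fun pr => δL^[pr.2] (b (s pr.1))) f = 0 → f = 0) ↔
      ∃ θ ∈ Θ, (∀ e ∈ θ.1, specialize δ a e = 0) ∧ specialize δ a θ.2 ≠ 0 := by
    intro a
    have h := hΘ F δF (ι.comp (specialize δ a)) hδF fun x => by
      rw [RingHom.comp_apply, specialize_derivation hD₀ hC₀ hX₀ hD hC hX, hιD,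
        RingHom.comp_apply]
    simp only [RingHom.comp_apply, map_eq_zero_iff ι hι, map_ne_zero_iff ι hι, ne_eq] at h
    simp only [ne_eq, ← h]
    have hτ : ∀ {L : Type u} [Field L] (δL : L → L) (j : F →+* L),
        (∀ x, j (δF x) = δL (j x)) → ∀ (b : Fin n → L) p,
        devalHom (j.comp (ι.comp (specialize δ a))) δL b (τ p) =
          devalMap ((j.comp ι).comp MvPolynomial.C) δL p
            (Sum.elim (fun i => (j.comp ι).comp MvPolynomial.C (a i)) b) :=
      fun δL j hj b p => devalHom_map_rename_splitParams (j.comp ι)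
        (fun x => by rw [RingHom.comp_apply, hιC, hj]; rfl) a b p
    constructor
    · rintro ⟨L, _, ιL, δL, hδL, hιL, b, ⟨hE, hG⟩, hind⟩
      obtain ⟨j, hj, hjD⟩ := hlift L δL (devalHom ιL δL (b ∘ s)) hδL
        ((injective_iff_map_eq_zero _).2 hind) (devalHom_derivation hδL hιL hD hC hX _)
      have hιj : (j.comp ι).comp MvPolynomial.C = ιL := by
        rw [hj]
        ext x
        exact devalHom_C _ _ _ _
      refine ⟨L, inferInstance, j, δL, hδL, hjD, b, fun e he => ?_, ?_⟩
      · obtain he | he := Finset.mem_union.1 he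
        · obtain ⟨i, -, rfl⟩ := Finset.mem_image.1 he
          rw [hτ δL j hjD, hιj]
          exact hE i
        · obtain ⟨l, -, rfl⟩ := Finset.mem_image.1 he
          rw [map_sub, devalHom_X, devalHom_C, RingHom.comp_apply, RingHom.comp_apply,
            specialize_X_inr, ← RingHom.comp_apply, hj, devalHom_X]
          exact sub_self _
      · rw [map_prod]
        refine Finset.prod_ne_zero_iff.2 fun i _ => ?_
        rw [hτ δL j hjD, hιj]
        exact hG i
    · rintro ⟨L, _, j, δL, hδL, hjD, b, hE, hG⟩
      have hb : ∀ l, b (s l) = j (ι (.X (l, 0))) := fun l => by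
        have := hE _ (Finset.mem_union_right _ (Finset.mem_image_of_mem _ (Finset.mem_univ l)))
        rw [map_sub, devalHom_X, devalHom_C, RingHom.comp_apply, RingHom.comp_apply,
          specialize_X_inr] at this
        exact sub_eq_zero.1 this
      refine ⟨L, inferInstance, (j.comp ι).comp MvPolynomial.C, δL, hδL, fun x => ?_, b,
        ⟨fun i => ?_, fun i h => ?_⟩, fun f hf => ?_⟩
      · simp only [RingHom.comp_apply, hιC, hjD]
      · rw [← hτ δL j hjD]
        exact hE _ (Finset.mem_union_left _ (Finset.mem_image_of_mem _ (Finset.mem_univ i)))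
      · rw [← hτ δL j hjD] at h
        rw [map_prod] at hG
        exact Finset.prod_ne_zero_iff.1 hG i (Finset.mem_univ i) h
      · have hev : (fun pr : Fin d × ℕ => δL^[pr.2] (b (s pr.1))) =
            fun pr => j.comp ι (.X pr) := by
          funext ⟨l, k⟩
          rw [← hDiter, RingHom.comp_apply, map_iterate_of_map hιD, map_iterate_of_map hjD, hb]
        rw [hev, ← MvPolynomial.coe_eval₂Hom] at hf
        have : MvPolynomial.eval₂Hom ((j.comp ι).comp MvPolynomial.C)
            (fun pr => j.comp ι (.X pr)) = j.comp ι :=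
          MvPolynomial.ringHom_ext (fun r => by simp) fun i => by simp
        rw [this, RingHom.comp_apply, map_eq_zero, map_eq_zero_iff ι hι] at hf
        exact hf
  have hset : {a : Fin m → K | ∃ (L : Type u) (_ : Field L) (ι : K →+* L) (δL : L → L),
      IsDerivationFn δL ∧ (∀ x, ι (δ x) = δL (ι x)) ∧ ∃ b : Fin n → L,
        ((∀ i, devalMap ι δL (E i) (Sum.elim (fun i => ι (a i)) b) = 0) ∧
          ∀ j, devalMap ι δL (G j) (Sum.elim (fun i => ι (a i)) b) ≠ 0) ∧
        ∀ f : MvPolynomial (Fin d × ℕ) K,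
          MvPolynomial.eval₂ ι (fun pr => δL^[pr.2] (b (s pr.1))) f = 0 → f = 0} =
      ⋃ θ : Θ, (⋂ e ∈ θ.1.1, {a | specialize δ a e = 0}) \ {a | specialize δ a θ.1.2 = 0} := by
    ext a
    refine (key a).trans ?_
    simp only [Set.mem_iUnion, Set.mem_sdiff, Set.mem_iInter, Subtype.exists, exists_prop]
    rfl
  rw [hset]
  refine BooleanSubalgebra.iUnion_mem _ fun θ => BooleanSubalgebra.sdiff_mem
    (BooleanSubalgebra.subset_closure ?_) (BooleanSubalgebra.subset_closure ?_)
  · let := kolchinTopology K δ (Fin m)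
    exact isClosed_biInter fun e _ => isClosed_setOf_specialize_eq_zero δ e
  · exact isClosed_setOf_specialize_eq_zero δ _

theorem setOf_diffDimGe_mem_closure [CharZero K] {δ : K → K} (hδ : IsDerivationFn δ)
    {m n p : ℕ} {q r : Fin p → ℕ}
    (E : (k : Fin p) → Fin (q k) → MvPolynomial ((Fin m ⊕ Fin n) × ℕ) K)
    (G : (k : Fin p) → Fin (r k) → MvPolynomial ((Fin m ⊕ Fin n) × ℕ) K) (d : ℕ) :
    {a | DiffDimGe δ E G a d} ∈
      BooleanSubalgebra.closure {C | IsClosed[kolchinTopology K δ (Fin m)] C} := by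
  have := BooleanSubalgebra.iUnion_mem _ fun k => BooleanSubalgebra.iUnion_mem _
    fun s : {s : Fin d → Fin n // Function.Injective s} =>
      setOf_exists_independent_solution_mem_closure hδ (E k) (G k) s.1
  convert this using 1
  ext a
  simp only [Set.mem_iUnion]
  constructor
  · rintro ⟨L, _, ι, δL, hδL, hι, b, ⟨k, hk⟩, s, hs, hind⟩
    exact ⟨k, ⟨s, hs⟩, L, inferInstance, ι, δL, hδL, hι, b, hk, hind⟩
  · rintro ⟨k, ⟨s, hs⟩, L, _, ι, δL, hδL, hι, b, hk, hind⟩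
    exact ⟨L, inferInstance, ι, δL, hδL, hι, b, ⟨k, hk⟩, s, hs, hind⟩

end DifferentialDimension

/-- Differential dimension is definable in families: for a differentially closed
field `(K, δ)` of characteristic zero and a finite Boolean combination `φ` of
differential polynomial equations in `u₁, …, u_m, x₁, …, xₙ` (in disjunctive
normal form `E`, `G`), the set of parameters `a ∈ K^m` for which `φ(a, ·)`
defines a nonempty set of differential dimension exactly `d` is a differentially
constructible subset of `K^m`. -/
theorem diffDim_definable_in_families {K : Type u} [Field K] [CharZero K]
    (δ : K → K) (hK : DiffClosedField K δ) (m n p : ℕ) (q r : Fin p → ℕ)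
    (E : (k : Fin p) → Fin (q k) → MvPolynomial ((Fin m ⊕ Fin n) × ℕ) K)
    (G : (k : Fin p) → Fin (r k) → MvPolynomial ((Fin m ⊕ Fin n) × ℕ) K)
    (d : ℕ) :
    IsConstructibleIn (kolchinTopology K δ (Fin m))
      {a | DiffDimGe δ E G a d ∧ ¬ DiffDimGe δ E G a (d + 1)} := by
  exact .of_mem_closure _ (BooleanSubalgebra.sdiff_mem
    (setOf_diffDimGe_mem_closure hK.1 E G d) (setOf_diffDimGe_mem_closure hK.1 E G (d + 1)))
end

section
/- Let (K, δ) be a differentially closed differential field of characteristic zero, let d ≥ 1, and let X ⊆ K^d be a differentially constructible set. Then X is dense in K^d with respect to the Kolchin topology if and only if there exist b₁, …, b_{d+1} ∈ K^d such that the translates (b₁ + X) ∪ ⋯ ∪ (b_{d+1} + X) cover K^d. -/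
universe u

open AlgebraicIndependent in
theorem mem_matroid_closure_iff {K L : Type*} [Field K] [Field L] [Algebra K L] {S : Set L}
    {a : L} : a ∈ (matroid K L).closure S ↔ IsAlgebraic (Algebra.adjoin K S) a := by
  rw [matroid_closure_eq]; rfl

namespace Derivation

variable {K L : Type*} [Field K] [Field L] [Algebra K L] (D : Derivation ℤ L L)

/-- The elements of an intermediate field `C` whose derivative also lies in `C`. -/
def derivInField (C : IntermediateField K L)
    (hD : ∀ c : K, D (algebraMap K L c) ∈ C) : IntermediateField K L where
  carrier := {x | x ∈ C ∧ D x ∈ C}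
  mul_mem' := fun {a b} ha hb ↦ ⟨C.mul_mem ha.1 hb.1, by
    rw [D.leibniz]
    exact C.add_mem (C.mul_mem ha.1 hb.2) (C.mul_mem hb.1 ha.2)⟩
  add_mem' := fun {a b} ha hb ↦ ⟨C.add_mem ha.1 hb.1, by
    rw [D.map_add]
    exact C.add_mem ha.2 hb.2⟩
  algebraMap_mem' := fun c ↦ ⟨C.algebraMap_mem c, hD c⟩
  inv_mem' := fun a ha ↦ ⟨C.inv_mem ha.1, by
    rw [D.leibniz_inv, smul_eq_mul]
    exact C.mul_mem (C.neg_mem (pow_mem (C.inv_mem ha.1) 2)) ha.2⟩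

theorem aeval_sub_mem (C : IntermediateField K L) (hD : ∀ c : K, D (algebraMap K L c) ∈ C)
    {a : L} (ha : a ∈ C) (p : Polynomial (D.derivInField C hD)) :
    D (Polynomial.aeval a p) - Polynomial.aeval a p.derivative * D a ∈ C := by
  induction p using Polynomial.induction_on' with
  | add p q hp hq =>
    convert C.add_mem hp hq using 1
    simp only [map_add]
    ring
  | monomial n c =>
    convert C.mul_mem (pow_mem ha n) c.2.2 using 1
    simp only [Polynomial.aeval_monomial, Polynomial.derivative_monomial, D.leibniz,
      D.leibniz_pow, smul_eq_mul, nsmul_eq_mul, map_mul,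
      IntermediateField.algebraMap_apply]
    push_cast
    ring

theorem mem_of_isAlgebraic_derivInField [CharZero L] (C : IntermediateField K L)
    (hD : ∀ c : K, D (algebraMap K L c) ∈ C) (hC : ∀ a : L, IsAlgebraic C a → a ∈ C)
    {a : L} (ha : IsAlgebraic (D.derivInField C hD) a) : a ∈ D.derivInField C hD := by
  have hle : D.derivInField C hD ≤ C := fun x hx ↦ hx.1
  have haC : a ∈ C := hC a
    (IsAlgebraic.tower_top_of_subalgebra_le (A := (D.derivInField C hD).toSubalgebra)
      (B := C.toSubalgebra) hle ha)
  refine ⟨haC, ?_⟩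
  set p := minpoly (D.derivInField C hD) a
  have hp0 : Polynomial.aeval a p = 0 := minpoly.aeval _ _
  have hp1 : Polynomial.aeval a p.derivative ≠ 0 :=
    (minpoly.irreducible ha.isIntegral).separable.aeval_derivative_ne_zero hp0
  have hmem : Polynomial.aeval a p.derivative ∈ C := by
    rw [Polynomial.aeval_eq_sum_range]
    refine C.sum_mem fun i _ ↦ ?_
    rw [Algebra.smul_def]
    exact C.mul_mem (hle (SetLike.coe_mem _)) (pow_mem haC i)
  have h := D.aeval_sub_mem C hD haC p
  rw [hp0, map_zero, zero_sub] at h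
  have h2 := C.mul_mem (C.inv_mem hmem) (C.neg_mem h)
  rwa [neg_neg, inv_mul_cancel_left₀ hp1] at h2

open AlgebraicIndependent in
/-- If `a` is algebraic over `S`, then `D a` is algebraic over `T` as soon as `T` is large enough
to make `S` and `D S` algebraic. -/
theorem mem_matroid_closure [CharZero L]
    (hD : ∀ c : K, D (algebraMap K L c) ∈ Set.range (algebraMap K L)) {S T : Set L}
    (hS : S ⊆ (matroid K L).closure T) (hDS : ∀ s ∈ S, D s ∈ (matroid K L).closure T)
    {a : L} (ha : a ∈ (matroid K L).closure S) : D a ∈ (matroid K L).closure T := by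
  let C : IntermediateField K L :=
    ((Subalgebra.algebraicClosure (Algebra.adjoin K T) L).restrictScalars K).toIntermediateField
      fun x hx ↦ IsAlgebraic.inv (R := Algebra.adjoin K T) hx
  have hCmem : ∀ x, x ∈ C ↔ x ∈ (matroid K L).closure T := fun x ↦ by
    rw [mem_matroid_closure_iff]; rfl
  have hCset : (C : Set L) = (matroid K L).closure T := Set.ext hCmem
  have hC : ∀ a : L, IsAlgebraic C a → a ∈ C := fun a ha ↦ by
    rw [hCmem, ← Matroid.closure_closure, ← hCset, mem_matroid_closure_iff]
    exact IsAlgebraic.tower_top_of_subalgebra_le (A := C.toSubalgebra)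
      (B := Algebra.adjoin K (C : Set L)) (fun x hx ↦ Algebra.subset_adjoin hx) ha
  have hDC : ∀ c : K, D (algebraMap K L c) ∈ C := fun c ↦ by
    obtain ⟨e, he⟩ := hD c
    exact he ▸ C.algebraMap_mem e
  rw [mem_matroid_closure_iff] at ha
  rw [← hCmem]
  have hle : Algebra.adjoin K S ≤ (D.derivInField C hDC).toSubalgebra :=
    Algebra.adjoin_le fun s hs ↦ ⟨(hCmem s).2 (hS hs), (hCmem _).2 (hDS s hs)⟩
  exact (D.mem_of_isAlgebraic_derivInField C hDC hC
    (IsAlgebraic.tower_top_of_subalgebra_le hle ha)).2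

end Derivation

open AlgebraicIndependent in
/-- A sequence with no term algebraic over its predecessors is algebraically independent. -/
theorem algebraicIndependent_nat_of_notMem_closure {K L : Type*} [Field K] [Field L] [Algebra K L]
    {u : ℕ → L} (hu : ∀ k, u k ∉ (matroid K L).closure (u '' Set.Iio k)) :
    AlgebraicIndependent K u := by
  have h : ∀ k, AlgebraicIndepOn K u (Set.Iio k) := by
    intro k
    induction k with
    | zero =>
      rw [show Set.Iio 0 = (∅ : Set ℕ) from Set.Iio_bot, AlgebraicIndepOn,
        algebraicIndependent_empty_type_iff]
      exact (algebraMap K L).injective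
    | succ k ih =>
      have : Set.Iio (k + 1) = insert k (Set.Iio k) := by ext; simp
      rw [this, AlgebraicIndepOn.insert_iff (by simp)]
      exact ⟨ih, fun h ↦ hu k (mem_matroid_closure_iff.2 h)⟩
  refine algebraicIndependent_of_finite_type fun t ht ↦ ?_
  obtain ⟨N, hN⟩ := ht.bddAbove
  exact (h (N + 1)).mono fun i hi ↦ Nat.lt_succ_of_le (hN hi)

open AlgebraicIndependent in
/-- A differentially dependent `d`-tuple, listed as a sequence on which the derivation is the shift
by `d`, has differential transcendence degree less than `d`. -/
theorem exists_eRk_le_of_not_algebraicIndependent {K L : Type*} [Field K] [Field L] [CharZero L]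
    [Algebra K L] (D : Derivation ℤ L L)
    (hD : ∀ c : K, D (algebraMap K L c) ∈ Set.range (algebraMap K L)) {d : ℕ} (hd : 1 ≤ d)
    {u : ℕ → L} (hDu : ∀ k, D (u k) = u (k + d)) (hu : ¬ AlgebraicIndependent K u) :
    ∃ k : ℕ, ∀ n : ℕ,
      (matroid K L).eRk (u '' Set.Iio (n * d)) ≤ ((k + n * (d - 1) : ℕ) : ℕ∞) := by
  obtain ⟨k, hk⟩ : ∃ k, u k ∈ (matroid K L).closure (u '' Set.Iio k) := by
    by_contra! h
    exact hu (algebraicIndependent_nat_of_notMem_closure h)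
  have hsub : ∀ s : Set L, s ⊆ (matroid K L).closure s := fun s ↦
    (matroid K L).subset_closure s (by simp)
  have hcl : ∀ n, u (k + n * d) ∈ (matroid K L).closure (u '' Set.Iio (k + n * d)) := by
    intro n
    induction n with
    | zero => simpa using hk
    | succ n ih =>
      rw [show k + (n + 1) * d = k + n * d + d by ring, ← hDu]
      refine D.mem_matroid_closure hD ?_ ?_ ih
      · exact (Set.image_mono (Set.Iio_subset_Iio (by omega))).trans (hsub _)
      · rintro _ ⟨i, hi, rfl⟩
        rw [hDu]
        exact hsub _ ⟨i + d, by simp at hi ⊢; omega, rfl⟩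
  have hrk : ∀ n, (matroid K L).eRk (u '' Set.Iio (k + n * d)) ≤
      ((k + n * (d - 1) : ℕ) : ℕ∞) := by
    intro n
    induction n with
    | zero =>
      refine ((matroid K L).eRk_le_encard _).trans ((Set.encard_image_le _ _).trans ?_)
      simp [← Finset.coe_Iio, Set.encard_coe_eq_coe_finsetCard]
    | succ n ih =>
      have hss : u '' Set.Iio (k + (n + 1) * d) ⊆ (matroid K L).closure
          (u '' Set.Iio (k + n * d) ∪ u '' Set.Ioo (k + n * d) (k + (n + 1) * d)) := by
        rintro _ ⟨i, hi, rfl⟩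
        rcases lt_trichotomy i (k + n * d) with h | rfl | h
        · exact hsub _ (Or.inl ⟨i, h, rfl⟩)
        · exact (matroid K L).closure_subset_closure Set.subset_union_left (hcl n)
        · exact hsub _ (Or.inr ⟨i, ⟨h, hi⟩, rfl⟩)
      refine ((matroid K L).eRk_mono hss).trans ?_
      rw [Matroid.eRk_closure_eq]
      refine ((matroid K L).eRk_union_le_eRk_add_encard _ _).trans ?_
      rw [show k + (n + 1) * (d - 1) = k + n * (d - 1) + (d - 1) by ring, Nat.cast_add]
      refine add_le_add ih ((Set.encard_image_le _ _).trans ?_)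
      rw [← Finset.coe_Ioo, Set.encard_coe_eq_coe_finsetCard, Nat.card_Ioo]
      refine Nat.cast_le.2 ?_
      rw [add_mul, one_mul]
      omega
  exact ⟨k, fun n ↦ ((matroid K L).eRk_mono
    (Set.image_mono (Set.Iio_subset_Iio (by omega)))).trans (hrk n)⟩

namespace IsDerivationFn

variable {R : Type*} [CommRing R] {δ : R → R}

/-- A function satisfying `IsDerivationFn` as a bundled derivation. -/
def toDerivation_s3 (h : IsDerivationFn δ) : Derivation ℤ R R :=
  Derivation.mk' (AddMonoidHom.mk' δ h.1).toIntLinearMap h.2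

/-- The ring homomorphism `a ↦ ι a + ι (δ a) ε` to the dual numbers of a ring extension. -/
def toDualNumber (h : IsDerivationFn δ) {S : Type*} [CommRing S] (ι : R →+* S) :
    R →+* DualNumber S where
  toFun a := TrivSqZeroExt.inl (ι a) + TrivSqZeroExt.inr (ι (δ a))
  map_one' := by
    have : δ 1 = 0 := h.toDerivation_s3.map_one_eq_zero
    ext <;> simp [this]
  map_zero' := by
    have : δ 0 = 0 := h.toDerivation_s3.map_zero
    ext <;> simp [this]
  map_add' a b := by
    ext <;> simp [h.1]
  map_mul' a b := by
    ext <;> simp [h.2, mul_comm]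

@[simp]
theorem fst_toDualNumber (h : IsDerivationFn δ) {S : Type*} [CommRing S] (ι : R →+* S) (a : R) :
    (h.toDualNumber ι a).fst = ι a := by
  simp [toDualNumber]

@[simp]
theorem snd_toDualNumber (h : IsDerivationFn δ) {S : Type*} [CommRing S] (ι : R →+* S) (a : R) :
    (h.toDualNumber ι a).snd = ι (δ a) := by
  simp [toDualNumber]

/-- A ring homomorphism to the dual numbers lifting the identity defines a derivation. -/
theorem snd_of_fst {φ : R →+* DualNumber R} (hφ : ∀ a, (φ a).fst = a) :
    IsDerivationFn fun a ↦ (φ a).snd :=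
  ⟨fun a b ↦ by simp, fun a b ↦ by simp [hφ, mul_comm]⟩

end IsDerivationFn

/-- The ring homomorphism to the dual numbers encoding the derivation of the ring of differential
polynomials, with values in its fraction field. -/
noncomputable def diffPolyToDualNumber {K σ : Type*} [Field K] {δ : K → K}
    (hδ : IsDerivationFn δ) :
    MvPolynomial (σ × ℕ) K →+* DualNumber (FractionRing (MvPolynomial (σ × ℕ) K)) :=
  MvPolynomial.eval₂Hom
    (hδ.toDualNumber (algebraMap K (FractionRing (MvPolynomial (σ × ℕ) K))))
    fun p ↦ TrivSqZeroExt.inl (algebraMap (MvPolynomial (σ × ℕ) K) _ (MvPolynomial.X p)) +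
      TrivSqZeroExt.inr (algebraMap (MvPolynomial (σ × ℕ) K) _ (MvPolynomial.X (p.1, p.2 + 1)))

theorem diffPolyToDualNumber_C {K σ : Type*} [Field K] {δ : K → K} (hδ : IsDerivationFn δ)
    (a : K) : diffPolyToDualNumber (σ := σ) hδ (MvPolynomial.C a) =
      hδ.toDualNumber (algebraMap K (FractionRing (MvPolynomial (σ × ℕ) K))) a :=
  MvPolynomial.eval₂Hom_C _ _ _

theorem diffPolyToDualNumber_X {K σ : Type*} [Field K] {δ : K → K} (hδ : IsDerivationFn δ)
    (p : σ × ℕ) : diffPolyToDualNumber hδ (MvPolynomial.X p) =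
      TrivSqZeroExt.inl (algebraMap (MvPolynomial (σ × ℕ) K) _ (MvPolynomial.X p)) +
        TrivSqZeroExt.inr (algebraMap (MvPolynomial (σ × ℕ) K) _
          (MvPolynomial.X (p.1, p.2 + 1))) :=
  MvPolynomial.eval₂Hom_X' _ _ _

theorem fst_diffPolyToDualNumber {K σ : Type*} [Field K] {δ : K → K}
    (hδ : IsDerivationFn δ) (f : MvPolynomial (σ × ℕ) K) :
    (diffPolyToDualNumber hδ f).fst = algebraMap _ _ f := by
  induction f using MvPolynomial.induction_on with
  | C a =>
    rw [diffPolyToDualNumber_C, IsDerivationFn.fst_toDualNumber,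
      IsScalarTower.algebraMap_apply K (MvPolynomial (σ × ℕ) K), MvPolynomial.algebraMap_eq]
  | add p q hp hq => simp [hp, hq]
  | mul_X p i hp =>
    rw [map_mul, TrivSqZeroExt.fst_mul, hp, map_mul, diffPolyToDualNumber_X]
    simp

/-- Every differential field has a differential field extension with a differentially generic
tuple. -/
theorem exists_generic_extension {K : Type u} {σ : Type} [Field K]
    {δ : K → K} (hδ : IsDerivationFn δ) :
    ∃ (L : Type u) (_ : Field L) (ι : K →+* L) (δL : L → L),
      IsDerivationFn δL ∧ (∀ x, ι (δ x) = δL (ι x)) ∧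
        ∃ b : σ → L, ∀ f : MvPolynomial (σ × ℕ) K, f ≠ 0 → devalMap ι δL f b ≠ 0 := by
  let R := MvPolynomial (σ × ℕ) K
  let L := FractionRing R
  have hu : ∀ y : nonZeroDivisors R, IsUnit (diffPolyToDualNumber hδ (y : R)) := fun y ↦ by
    rw [TrivSqZeroExt.isUnit_iff_isUnit_fst, fst_diffPolyToDualNumber]
    exact IsLocalization.map_units L y
  let φ : L →+* DualNumber L := IsLocalization.lift hu
  have hφR : ∀ f : R, φ (algebraMap R L f) = diffPolyToDualNumber hδ f :=
    IsLocalization.lift_eq hu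
  have hφ : ∀ a, (φ a).fst = a := by
    have : ((TrivSqZeroExt.fstHom L L L : DualNumber L →+* L).comp φ) = RingHom.id L := by
      refine IsLocalization.ringHom_ext (nonZeroDivisors R) (RingHom.ext fun f ↦ ?_)
      simp only [RingHom.comp_apply, RingHom.id_apply, hφR]
      exact fst_diffPolyToDualNumber hδ f
    exact fun a ↦ RingHom.congr_fun this a
  have hX : ∀ (i : σ) (j : ℕ), (fun a ↦ (φ a).snd)^[j] (algebraMap R L (MvPolynomial.X (i, 0))) =
      algebraMap R L (MvPolynomial.X (i, j)) := by
    intro i j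
    induction j with
    | zero => rfl
    | succ j ih =>
      rw [Function.iterate_succ_apply', ih, hφR]
      simp only [diffPolyToDualNumber_X, TrivSqZeroExt.snd_add, TrivSqZeroExt.snd_inl,
        TrivSqZeroExt.snd_inr, zero_add]
      rfl
  refine ⟨L, inferInstance, algebraMap K L, fun a ↦ (φ a).snd, IsDerivationFn.snd_of_fst hφ,
    fun x ↦ ?_, fun i ↦ algebraMap R L (MvPolynomial.X (i, 0)), fun f hf ↦ ?_⟩
  · change _ = (φ (algebraMap K L x)).snd
    rw [IsScalarTower.algebraMap_apply K R L x, hφR, MvPolynomial.algebraMap_eq]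
    exact ((congrArg TrivSqZeroExt.snd (diffPolyToDualNumber_C hδ x)).trans
      (IsDerivationFn.snd_toDualNumber hδ _ x)).symm
  · have : devalMap (algebraMap K L) (fun a ↦ (φ a).snd) f
        (fun i ↦ algebraMap R L (MvPolynomial.X (i, 0))) = algebraMap R L f := by
      simp only [devalMap, hX]
      refine RingHom.congr_fun (f := MvPolynomial.eval₂Hom (algebraMap K L)
        fun p ↦ algebraMap R L (MvPolynomial.X p)) (g := algebraMap R L)
        (MvPolynomial.ringHom_ext (fun r ↦ ?_) fun i ↦ ?_) f
      · rw [MvPolynomial.eval₂Hom_C, IsScalarTower.algebraMap_apply K R L,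
          MvPolynomial.algebraMap_eq]
      · rw [MvPolynomial.eval₂Hom_X']
    rw [this]
    simpa [L, R] using hf

open AlgebraicIndependent in
/-- If the `d + 1` tuples `b i` of length `d` are jointly differentially independent, then for
every `x` one of the tuples `x - b i` is differentially independent. -/
theorem exists_algebraicIndependent_sub {K L : Type*} [Field K] [Field L] [CharZero L]
    [Algebra K L] (D : Derivation ℤ L L)
    (hD : ∀ c : K, D (algebraMap K L c) ∈ Set.range (algebraMap K L)) {d : ℕ} (hd : 1 ≤ d)
    {b : Fin (d + 1) × Fin d → L}
    (hb : AlgebraicIndependent K fun p : (Fin (d + 1) × Fin d) × ℕ ↦ D^[p.2] (b p.1))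
    (x : Fin d → L) :
    ∃ i, AlgebraicIndependent K fun p : Fin d × ℕ ↦ D^[p.2] (x p.1 - b (i, p.1)) := by
  by_contra! hdep
  have : NeZero d := ⟨by omega⟩
  let e : ℕ ≃ Fin d × ℕ := (Nat.divModEquiv d).trans (Equiv.prodComm _ _)
  have hmk : ∀ k, e (k + d) = ((e k).1, (e k).2 + 1) := fun k ↦ by
    apply Prod.ext
    · apply Fin.ext
      simp [e]
    · simp [e, Nat.add_div_right k (show 0 < d by omega)]
  have hlt : ∀ {n k : ℕ}, (e k).2 < n → k < n * d := fun {n k} h ↦ by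
    have h' : k / d < n := by simpa [e] using h
    exact (Nat.div_lt_iff_lt_mul (by omega)).1 h'
  let u (i : Fin (d + 1)) (k : ℕ) : L := D^[(e k).2] (x (e k).1 - b (i, (e k).1))
  have hex : ∀ i, ∃ k : ℕ, ∀ n : ℕ,
      (matroid K L).eRk (u i '' Set.Iio (n * d)) ≤ ((k + n * (d - 1) : ℕ) : ℕ∞) := fun i ↦ by
    refine exists_eRk_le_of_not_algebraicIndependent D hD hd (fun k ↦ ?_) fun h ↦ hdep i ?_
    · simp only [u, hmk, Function.iterate_succ_apply']
    · exact (algebraicIndependent_equiv e).1 h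
  choose k hk using hex
  set n := ∑ i, k i + 1 with hn
  let B : (Fin (d + 1) × Fin d) × Fin n → L := fun p ↦ D^[p.2] (b p.1)
  let X : Fin d × Fin n → L := fun p ↦ D^[p.2] (x p.1)
  have hB : AlgebraicIndependent K B :=
    hb.comp (Prod.map id Fin.val) (Function.injective_id.prodMap Fin.val_injective)
  have hBcard : (matroid K L).eRk (Set.range B) = (((d + 1) * d * n : ℕ) : ℕ∞) := by
    have hind : (matroid K L).Indep (Set.range B) := matroid_indep_iff.2 hB.coe_range
    rw [hind.eRk_eq_encard, ← Set.image_univ, hB.injective.encard_image, Set.encard_univ]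
    simp
  have hXcard : (Set.range X).encard ≤ ((d * n : ℕ) : ℕ∞) := by
    rw [← Set.image_univ]
    refine (Set.encard_image_le _ _).trans ?_
    rw [Set.encard_univ]
    simp
  have hsub : Set.range B ⊆
      (matroid K L).closure ((⋃ i, u i '' Set.Iio (n * d)) ∪ Set.range X) := by
    rintro _ ⟨⟨⟨i, m⟩, j⟩, rfl⟩
    have h1 : D^[j] (x m) ∈
        (matroid K L).closure ((⋃ i, u i '' Set.Iio (n * d)) ∪ Set.range X) :=
      (matroid K L).subset_closure _ (by simp) (Or.inr ⟨(m, j), rfl⟩)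
    have h2 : D^[j] (x m - b (i, m)) ∈
        (matroid K L).closure ((⋃ i, u i '' Set.Iio (n * d)) ∪ Set.range X) := by
      refine (matroid K L).subset_closure _ (by simp)
        (Or.inl (Set.mem_iUnion.2 ⟨i, e.symm (m, j), hlt ?_, ?_⟩))
      · simp
      · simp [u]
    rw [mem_matroid_closure_iff] at h1 h2 ⊢
    have h3 : B ((i, m), j) = D^[j] (x m) - D^[j] (x m - b (i, m)) := by
      rw [iterate_map_sub D j, sub_sub_cancel]
    rw [h3]
    exact h1.sub h2
  have hunion : ∀ s : Finset (Fin (d + 1)),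
      (matroid K L).eRk (⋃ i ∈ s, u i '' Set.Iio (n * d)) ≤
        ((∑ i ∈ s, (k i + n * (d - 1)) : ℕ) : ℕ∞) := by
    intro s
    induction s using Finset.induction_on with
    | empty => simp
    | insert i s hi ih =>
      rw [Finset.set_biUnion_insert, Finset.sum_insert hi, Nat.cast_add]
      exact ((matroid K L).eRk_union_le_eRk_add_eRk _ _).trans (add_le_add (hk i n) ih)
  have hle := (matroid K L).eRk_mono hsub
  rw [Matroid.eRk_closure_eq, hBcard] at hle
  have hU := hunion Finset.univ
  simp only [Finset.mem_univ, Set.iUnion_true] at hU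
  have hfin := (hle.trans ((matroid K L).eRk_union_le_eRk_add_encard _ _)).trans
    (add_le_add hU hXcard)
  rw [← Nat.cast_add, Nat.cast_le, Finset.sum_add_distrib, Finset.sum_const, Finset.card_univ,
    Fintype.card_fin, smul_eq_mul] at hfin
  obtain ⟨c, rfl⟩ := Nat.exists_eq_add_of_le' hd
  rw [Nat.add_sub_cancel] at hfin
  have hid : (c + 1 + 1) * (c + 1) * n = (c + 1 + 1) * (n * c) + (c + 1) * n + n := by ring
  omega

theorem DiffClosedField.exists_devalMap_ne_zero {K : Type u} [Field K] {δ : K → K}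
    (hK : DiffClosedField K δ) {σ : Type} [Finite σ] {f : MvPolynomial (σ × ℕ) K} (hf : f ≠ 0) :
    ∃ a : σ → K, devalMap (RingHom.id K) δ f a ≠ 0 := by
  obtain ⟨n, ⟨e⟩⟩ := Finite.exists_equiv_fin σ
  have hinj : Function.Injective (Prod.map e id : σ × ℕ → Fin n × ℕ) :=
    e.injective.prodMap Function.injective_id
  obtain ⟨L, _, ι, δL, hδL, hι, b, hb⟩ := exists_generic_extension (σ := Fin n) hK.1
  obtain ⟨a, -, ha⟩ := hK.2 n 0 Fin.elim0 (MvPolynomial.rename (Prod.map e id) f)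
    ⟨L, _, ι, δL, hδL, hι, b, fun i ↦ i.elim0, hb _
      ((MvPolynomial.rename_injective _ hinj).ne_iff' (map_zero _) |>.2 hf)⟩
  refine ⟨a ∘ e, ?_⟩
  rw [devalMap, MvPolynomial.eval₂_rename] at ha
  exact ha

section devalMap

variable {K : Type*} [Field K] {δ : K → K} {σ : Type*}

theorem devalMap_mul (f g : MvPolynomial (σ × ℕ) K) (a : σ → K) :
    devalMap (RingHom.id K) δ (f * g) a =
      devalMap (RingHom.id K) δ f a * devalMap (RingHom.id K) δ g a :=
  MvPolynomial.eval₂_mul _ _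

theorem devalMap_one (a : σ → K) :
    devalMap (RingHom.id K) δ (1 : MvPolynomial (σ × ℕ) K) a = 1 :=
  MvPolynomial.eval₂_one _ _

theorem devalMap_zero (a : σ → K) :
    devalMap (RingHom.id K) δ (0 : MvPolynomial (σ × ℕ) K) a = 0 :=
  MvPolynomial.eval₂_zero _ _

theorem devalMap_prod {ι : Type*} (s : Finset ι) (f : ι → MvPolynomial (σ × ℕ) K) (a : σ → K) :
    devalMap (RingHom.id K) δ (∏ i ∈ s, f i) a =
      ∏ i ∈ s, devalMap (RingHom.id K) δ (f i) a :=
  map_prod (MvPolynomial.eval₂Hom (RingHom.id K) fun p : σ × ℕ ↦ δ^[p.2] (a p.1)) f s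

theorem exists_devalMap_sub (hδ : IsDerivationFn δ) (f : MvPolynomial (σ × ℕ) K) (b : σ → K) :
    ∃ f' : MvPolynomial (σ × ℕ) K, ∀ x,
      devalMap (RingHom.id K) δ f' x = devalMap (RingHom.id K) δ f (x - b) := by
  refine ⟨MvPolynomial.bind₁
    (fun p ↦ MvPolynomial.X p - MvPolynomial.C (δ^[p.2] (b p.1))) f, fun x ↦ ?_⟩
  rw [devalMap, devalMap, ← MvPolynomial.coe_eval₂Hom, ← MvPolynomial.coe_eval₂Hom,
    MvPolynomial.eval₂Hom_bind₁]
  congr 2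
  funext p
  have h : δ^[p.2] (x p.1 - b p.1) = δ^[p.2] (x p.1) - δ^[p.2] (b p.1) :=
    iterate_map_sub hδ.toDerivation_s3 p.2 _ _
  simp [h]

/-- The sets `f ≠ 0` form a basis of the Kolchin topology. -/
theorem exists_devalMap_ne_zero_subset {U : Set (σ → K)}
    (hU : @IsOpen _ (kolchinTopology K δ σ) U) {a : σ → K} (ha : a ∈ U) :
    ∃ f : MvPolynomial (σ × ℕ) K, devalMap (RingHom.id K) δ f a ≠ 0 ∧
      {x | devalMap (RingHom.id K) δ f x ≠ 0} ⊆ U := by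
  induction hU with
  | basic s hs =>
    obtain ⟨f, rfl⟩ := hs
    exact ⟨f, ha, subset_rfl⟩
  | univ => exact ⟨1, by simp [devalMap_one], Set.subset_univ _⟩
  | inter s t _ _ hs ht =>
    obtain ⟨f, hf, hfs⟩ := hs ha.1
    obtain ⟨g, hg, hgt⟩ := ht ha.2
    refine ⟨f * g, by simp [devalMap_mul, hf, hg], fun x hx ↦ ?_⟩
    rw [Set.mem_ofPred_eq, devalMap_mul] at hx
    exact ⟨hfs (left_ne_zero_of_mul hx), hgt (right_ne_zero_of_mul hx)⟩
  | sUnion S _ ih =>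
    obtain ⟨s, hs, has⟩ := ha
    obtain ⟨f, hf, hfs⟩ := ih s hs has
    exact ⟨f, hf, hfs.trans (Set.subset_sUnion_of_mem hs)⟩

theorem isOpen_devalMap_ne_zero (f : MvPolynomial (σ × ℕ) K) :
    @IsOpen _ (kolchinTopology K δ σ) {x | devalMap (RingHom.id K) δ f x ≠ 0} :=
  TopologicalSpace.isOpen_generateFrom_of_mem ⟨f, rfl⟩

theorem ne_zero_of_devalMap_ne_zero {f : MvPolynomial (σ × ℕ) K} {a : σ → K}
    (h : devalMap (RingHom.id K) δ f a ≠ 0) : f ≠ 0 := by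
  rintro rfl
  exact h (devalMap_zero a)

theorem exists_devalMap_ne_zero_subset_of_nonempty {U : Set (σ → K)}
    (hU : @IsOpen _ (kolchinTopology K δ σ) U) (hne : U.Nonempty) :
    ∃ f : MvPolynomial (σ × ℕ) K, f ≠ 0 ∧ {x | devalMap (RingHom.id K) δ f x ≠ 0} ⊆ U := by
  obtain ⟨a, ha⟩ := hne
  obtain ⟨f, hf, hfU⟩ := exists_devalMap_ne_zero_subset hU ha
  exact ⟨f, ne_zero_of_devalMap_ne_zero hf, hfU⟩

end devalMap

/-- A dense constructible set contains a nonempty basic open set. -/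
theorem IsConstructibleIn.exists_devalMap_ne_zero_subset_of_dense {K : Type u} [Field K]
    {δ : K → K} (hK : DiffClosedField K δ) {σ : Type} [Finite σ] {X : Set (σ → K)}
    (hX : IsConstructibleIn (kolchinTopology K δ σ) X)
    (hdense : @Dense _ (kolchinTopology K δ σ) X) :
    ∃ g : MvPolynomial (σ × ℕ) K, g ≠ 0 ∧ {x | devalMap (RingHom.id K) δ g x ≠ 0} ⊆ X := by
  let _ : TopologicalSpace (σ → K) := kolchinTopology K δ σ
  obtain ⟨r, C, D, hC, hD, rfl⟩ := hX
  have hf : ∀ i, ∃ f : MvPolynomial (σ × ℕ) K, f ≠ 0 ∧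
      (C i ≠ Set.univ → {x | devalMap (RingHom.id K) δ f x ≠ 0} ⊆ (C i)ᶜ) := fun i ↦ by
    by_cases hCi : C i = Set.univ
    · exact ⟨1, one_ne_zero, fun h ↦ (h hCi).elim⟩
    · obtain ⟨f, hf, hfC⟩ := exists_devalMap_ne_zero_subset_of_nonempty (hC i).isOpen_compl
        (Set.nonempty_compl.2 hCi)
      exact ⟨f, hf, fun _ ↦ hfC⟩
  choose f hf0 hfC using hf
  obtain ⟨y, hy, hyX⟩ := hdense.inter_open_nonempty _ (isOpen_devalMap_ne_zero (∏ i, f i))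
    (hK.exists_devalMap_ne_zero (Finset.prod_ne_zero_iff.2 fun i _ ↦ hf0 i))
  obtain ⟨i, hyC, hyD⟩ := Set.mem_iUnion.1 hyX
  rw [Set.mem_ofPred_eq, devalMap_prod, Finset.prod_ne_zero_iff] at hy
  have hCi : C i = Set.univ := by
    by_contra h
    exact hfC i h (hy i (Finset.mem_univ i)) hyC
  obtain ⟨g, hg, hgD⟩ := exists_devalMap_ne_zero_subset_of_nonempty (hD i).isOpen_compl ⟨y, hyD⟩
  exact ⟨g, hg, fun x hx ↦ Set.mem_iUnion.2 ⟨i, hCi ▸ Set.mem_univ x, hgD hx⟩⟩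

/-- If `d + 1` translates of a set cover the affine space, the set is Kolchin dense. -/
theorem dense_of_translates_cover {K : Type u} [Field K] {δ : K → K} (hK : DiffClosedField K δ)
    {σ ι : Type} [Finite σ] [Fintype ι] {X : Set (σ → K)} {b : ι → σ → K}
    (hb : ∀ x : σ → K, ∃ i, ∃ y ∈ X, x = b i + y) :
    @Dense _ (kolchinTopology K δ σ) X := by
  let _ : TopologicalSpace (σ → K) := kolchinTopology K δ σ
  rw [dense_iff_inter_open]
  intro U hU hne
  obtain ⟨a, haU⟩ := hne
  obtain ⟨f, hfa, hfU⟩ := exists_devalMap_ne_zero_subset hU haU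
  choose f' hf' using fun i ↦ exists_devalMap_sub hK.1 f (b i)
  have hf'0 : ∀ i, f' i ≠ 0 := fun i ↦ ne_zero_of_devalMap_ne_zero (δ := δ) (a := a + b i)
    (by rwa [hf', add_sub_cancel_right])
  obtain ⟨x, hx⟩ := hK.exists_devalMap_ne_zero (Finset.prod_ne_zero_iff.2 fun i _ ↦ hf'0 i)
  obtain ⟨i, y, hyX, rfl⟩ := hb x
  rw [devalMap_prod, Finset.prod_ne_zero_iff] at hx
  have := hx i (Finset.mem_univ i)
  rw [hf', add_sub_cancel_left] at this
  exact ⟨y, hfU this, hyX⟩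

section Germ

open Filter

variable {α K : Type*} [Field K]

theorem IsDerivationFn.germ_map {δ : K → K} (hδ : IsDerivationFn δ) (l : Filter α) :
    IsDerivationFn (Germ.map δ : l.Germ K → l.Germ K) := by
  constructor
  · intro a b
    induction a using Germ.inductionOn with | _ a
    induction b using Germ.inductionOn with | _ b
    exact congrArg _ (funext fun x ↦ hδ.1 (a x) (b x))
  · intro a b
    induction a using Germ.inductionOn with | _ a
    induction b using Germ.inductionOn with | _ b
    exact congrArg _ (funext fun x ↦ hδ.2 (a x) (b x))

theorem devalMap_germ_map (δ : K → K) (l : Filter α) {σ : Type*}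
    (f : MvPolynomial (σ × ℕ) K) (a : α → σ → K) :
    devalMap ((Germ.coeRingHom l).comp (Pi.constRingHom α K)) (Germ.map δ : l.Germ K → l.Germ K) f
        (fun i ↦ ((fun t ↦ a t i : α → K) : l.Germ K)) =
      ((fun t ↦ devalMap (RingHom.id K) δ f (a t) : α → K) : l.Germ K) := by
  have hiter : ∀ (j : ℕ) (h : α → K), (Germ.map δ : l.Germ K → l.Germ K)^[j] (h : l.Germ K) =
      ((fun t ↦ δ^[j] (h t) : α → K) : l.Germ K) := by
    intro j h
    induction j with
    | zero => rfl
    | succ j ih =>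
      rw [Function.iterate_succ_apply', ih]
      simp only [Function.iterate_succ_apply']
      rfl
  simp only [devalMap, hiter]
  induction f using MvPolynomial.induction_on with
  | C c => simp; rfl
  | add p q hp hq => simp only [MvPolynomial.eval₂_add, hp, hq]; rfl
  | mul_X p i hp => simp only [MvPolynomial.eval₂_mul, MvPolynomial.eval₂_X, hp]; rfl

end Germ

open Filter in
/-- Suitable `d + 1` translates of a nonempty basic open set cover the affine space. The translation
vectors are obtained by comparison with an ultrapower containing a generic family. -/
theorem DiffClosedField.exists_forall_exists_devalMap_sub_ne_zero {K : Type u} [Field K]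
    [CharZero K] {δ : K → K} (hK : DiffClosedField K δ) {d : ℕ} (hd : 1 ≤ d)
    {g : MvPolynomial (Fin d × ℕ) K} (hg : g ≠ 0) :
    ∃ b : Fin (d + 1) × Fin d → K, ∀ x : Fin d → K, ∃ i,
      devalMap (RingHom.id K) δ g (fun m ↦ x m - b (i, m)) ≠ 0 := by
  by_contra! hbad
  choose x hx using hbad
  let σ := Fin (d + 1) × Fin d
  let F : Filter (σ → K) := ⨅ H : {H : MvPolynomial (σ × ℕ) K // H ≠ 0},
    𝓟 {b | devalMap (RingHom.id K) δ H.1 b ≠ 0}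
  have : Nonempty {H : MvPolynomial (σ × ℕ) K // H ≠ 0} := ⟨⟨1, one_ne_zero⟩⟩
  have hF : F.NeBot := by
    refine iInf_neBot_of_directed' (fun H₁ H₂ ↦ ?_) fun H ↦
      principal_neBot_iff.2 (hK.exists_devalMap_ne_zero H.2)
    refine ⟨⟨H₁.1 * H₂.1, mul_ne_zero H₁.2 H₂.2⟩, ?_, ?_⟩ <;>
    · simp only [ge_iff_le, le_principal_iff, mem_principal]
      intro b hb
      rw [Set.mem_ofPred_eq, devalMap_mul] at hb
      first
        | exact left_ne_zero_of_mul hb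
        | exact right_ne_zero_of_mul hb
  let U := Ultrafilter.of F
  let L := (U : Filter (σ → K)).Germ K
  let ι : K →+* L := (Germ.coeRingHom (U : Filter (σ → K))).comp (Pi.constRingHom (σ → K) K)
  let _ : Algebra K L := ι.toAlgebra
  have hδL : IsDerivationFn (Germ.map δ : L → L) := hK.1.germ_map _
  have : CharZero L := charZero_of_injective_algebraMap (algebraMap K L).injective
  let bL : σ → L := fun p ↦ ((fun b : σ → K ↦ b p : (σ → K) → K) : L)
  let xL : Fin d → L := fun m ↦ ((fun b : σ → K ↦ x b m : (σ → K) → K) : L)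
  have hb : AlgebraicIndependent K fun p : σ × ℕ ↦ hδL.toDerivation_s3^[p.2] (bL p.1) := by
    rw [algebraicIndependent_iff]
    intro H hH
    by_contra hH0
    have h1 : ((fun b ↦ devalMap (RingHom.id K) δ H b : (σ → K) → K) : L) =
        ((fun _ ↦ 0 : (σ → K) → K) : L) :=
      (devalMap_germ_map δ (U : Filter (σ → K)) H fun b ↦ b).symm.trans hH
    have h2 : ∀ᶠ b in (U : Filter (σ → K)), devalMap (RingHom.id K) δ H b ≠ 0 :=
      (Ultrafilter.of_le F).trans (iInf_le _ ⟨H, hH0⟩) (mem_principal_self _)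
    obtain ⟨b, hb1, hb2⟩ := ((Germ.coe_eq.1 h1).and h2).exists
    exact hb2 hb1
  have hD : ∀ c : K, hδL.toDerivation_s3 (algebraMap K L c) ∈ Set.range (algebraMap K L) :=
    fun c ↦ ⟨δ c, rfl⟩
  obtain ⟨i, hi⟩ := exists_algebraicIndependent_sub hδL.toDerivation_s3 hD hd hb xL
  refine hg (algebraicIndependent_iff.1 hi g ?_)
  refine (devalMap_germ_map δ (U : Filter (σ → K)) g fun b m ↦ x b m - b (i, m)).trans ?_
  exact congrArg _ (funext fun b ↦ hx b i)

/-- A differentially constructible subset `X ⊆ K^d` over a differentially closed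
field of characteristic zero is Kolchin dense in `K^d` if and only if `d + 1`
additive translates of `X` cover `K^d`. -/
theorem dense_iff_translates_cover {K : Type u} [Field K] [CharZero K]
    (δ : K → K) (hK : DiffClosedField K δ) (d : ℕ) (hd : 1 ≤ d)
    (X : Set (Fin d → K))
    (hX : IsConstructibleIn (kolchinTopology K δ (Fin d)) X) :
    @Dense _ (kolchinTopology K δ (Fin d)) X ↔
      ∃ b : Fin (d + 1) → Fin d → K,
        ∀ x : Fin d → K, ∃ i, ∃ y ∈ X, x = b i + y := by
  constructor
  · intro hdense
    obtain ⟨g, hg, hgX⟩ := hX.exists_devalMap_ne_zero_subset_of_dense hK hdense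
    obtain ⟨b, hb⟩ := hK.exists_forall_exists_devalMap_sub_ne_zero hd hg
    refine ⟨fun i m ↦ b (i, m), fun x ↦ ?_⟩
    obtain ⟨i, hi⟩ := hb x
    exact ⟨i, fun m ↦ x m - b (i, m), hgX hi, funext fun m ↦ by simp⟩
  · rintro ⟨b, hb⟩
    exact dense_of_translates_cover hK hb
end
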